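/- arXiv:2401.10454 — 2 statements merged into one kernel-verified Lean document; each statement's English description precedes it below -/
import Mathlib

section
/- Let L be a countable first-order language and let T be an L-theory. Then the number of isomorphism classes of models of T with underlying set ℕ is either at most ℵ₁ or exactly 2^ℵ₀ (the cardinality of the continuum). -/
open FirstOrder Cardinal

/-- The setoid identifying two `L`-structures on `ℕ` that model `T` when they are
`L`-isomorphic. -/
def countableModelSetoid (L : Language) (T : L.Theory) :
    Setoid {S : L.Structure ℕ // @Language.Theory.Model L ℕ S T} where
  r S₁ S₂ := Nonempty (@Language.Equiv L ℕ ℕ S₁.1 S₂.1)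
  iseqv := by
    refine ⟨fun S => ⟨@Language.Equiv.refl L ℕ S.1⟩, ?_, ?_⟩
    · rintro S₁ S₂ ⟨e⟩
      exact ⟨@Language.Equiv.symm L ℕ ℕ S₁.1 S₂.1 e⟩
    · rintro S₁ S₂ S₃ ⟨e⟩ ⟨f⟩
      exact ⟨@Language.Equiv.comp L ℕ ℕ S₁.1 S₂.1 ℕ S₃.1 f e⟩

/-- A continuous map with uncountable image on a closed set can be split into two pieces of small
diameter which have disjoint uncountable images. -/
theorem exists_closed_small_splitting {α β : Type*} [MetricSpace α] [SecondCountableTopology α]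
    [TopologicalSpace β] [T2Space β] {f : α → β} (hf : Continuous f) {C : Set α}
    (hC : IsClosed C) (hunc : ¬ (f '' C).Countable) {ε : ENNReal} (hε : 0 < ε) :
    ∃ C₀ C₁ : Set α,
      (IsClosed C₀ ∧ ¬ (f '' C₀).Countable ∧ C₀ ⊆ C ∧ Metric.ediam C₀ ≤ ε) ∧
      (IsClosed C₁ ∧ ¬ (f '' C₁).Countable ∧ C₁ ⊆ C ∧ Metric.ediam C₁ ≤ ε) ∧
      Disjoint (f '' C₀) (f '' C₁) := by
  let B := TopologicalSpace.countableBasis α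
  let N : Set α := ⋃ U ∈ {U ∈ B | (f '' (U ∩ C)).Countable}, U ∩ C
  have hN : (f '' N).Countable := by
    simp only [N, Set.image_iUnion]
    refine Set.Countable.biUnion ?_ fun U hU => hU.2
    exact (TopologicalSpace.countable_countableBasis α).mono (Set.sep_subset _ _)
  have hcond : ∀ x ∈ C, x ∉ N → ∀ U, IsOpen U → x ∈ U → ¬ (f '' (U ∩ C)).Countable := by
    intro x hx hxN U hU hxU hc
    obtain ⟨V, hV, hxV, hVU⟩ :=
      (TopologicalSpace.isBasis_countableBasis α).exists_subset_of_mem_open hxU hU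
    refine hxN (Set.mem_biUnion (x := V) ⟨hV, hc.mono ?_⟩ ⟨hxV, hx⟩)
    exact Set.image_mono (Set.inter_subset_inter_left _ hVU)
  have hunc' : ¬ (f '' (C \ N)).Countable := fun h => hunc <| (h.union hN).mono <| by
    rw [← Set.image_union]
    exact Set.image_mono (by simp)
  have hnt : (f '' (C \ N)).Nontrivial := by
    by_contra h
    exact hunc' (Set.not_nontrivial_iff.1 h).countable
  obtain ⟨_, ⟨x, hx, rfl⟩, _, ⟨y, hy, rfl⟩, hxy⟩ := hnt
  obtain ⟨V, W, hV, hW, hxV, hyW, hVW⟩ := t2_separation hxy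
  have key : ∀ z ∈ C \ N, ∀ V : Set β, IsOpen V → f z ∈ V → ∃ D : Set α,
      (IsClosed D ∧ ¬ (f '' D).Countable ∧ D ⊆ C ∧ Metric.ediam D ≤ ε) ∧ f '' D ⊆ V := by
    intro z hz V hV hzV
    obtain ⟨r, hr, hrV⟩ := Metric.nhds_basis_closedEBall.mem_iff.1
      ((hV.preimage hf).mem_nhds hzV)
    have hs : 0 < min r (ε / 2) := lt_min hr (ENNReal.half_pos hε.ne')
    refine ⟨Metric.closedEBall z (min r (ε / 2)) ∩ C,
      ⟨Metric.isClosed_closedEBall.inter hC, fun h => ?_, Set.inter_subset_right, ?_⟩, ?_⟩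
    · refine hcond z hz.1 hz.2 _ Metric.isOpen_eball (Metric.mem_eball_self hs) (h.mono ?_)
      exact Set.image_mono (Set.inter_subset_inter_left _ Metric.eball_subset_closedEBall)
    · refine (Metric.ediam_mono Set.inter_subset_left).trans
        (Metric.ediam_closedEBall_le.trans ?_)
      calc 2 * min r (ε / 2) ≤ 2 * (ε / 2) := by gcongr; exact min_le_right _ _
        _ = ε := ENNReal.mul_div_cancel (by simp) (by simp)
    · rintro _ ⟨w, hw, rfl⟩
      exact hrV (Metric.closedEBall_subset_closedEBall (min_le_left _ _) hw.1)
  obtain ⟨C₀, h₀, hV'⟩ := key x hx V hV hxV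
  obtain ⟨C₁, h₁, hW'⟩ := key y hy W hW hyW
  exact ⟨C₀, C₁, h₀, h₁, hVW.mono hV' hW'⟩

open CantorScheme in
/-- The perfect set property for continuous images of Polish spaces. -/
theorem Continuous.exists_nat_bool_comp_injective {α β : Type*} [TopologicalSpace α]
    [PolishSpace α] [TopologicalSpace β] [T2Space β] {f : α → β} (hf : Continuous f)
    (hunc : ¬ (Set.range f).Countable) :
    ∃ φ : (ℕ → Bool) → α, Function.Injective (f ∘ φ) := by
  let := TopologicalSpace.upgradeIsCompletelyMetrizable α
  obtain ⟨u, -, upos', hu⟩ := exists_seq_strictAnti_tendsto' (zero_lt_one' ENNReal)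
  have upos := fun n => (upos' n).1
  let P := Subtype fun E : Set α => IsClosed E ∧ ¬ (f '' E).Countable
  choose C0 C1 h0 h1 hdisj using
    fun {C : Set α} (hC : IsClosed C) (hunc : ¬ (f '' C).Countable) {ε : ENNReal} (hε : 0 < ε) =>
    exists_closed_small_splitting hf hC hunc hε
  let DP : List Bool → P := fun l => by
    induction l with
    | nil => exact ⟨Set.univ, isClosed_univ, by rwa [Set.image_univ]⟩
    | cons a l ih =>
      cases a
      · use C0 ih.property.1 ih.property.2 (upos (l.length + 1))
        exact ⟨(h0 _ _ _).1, (h0 _ _ _).2.1⟩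
      use C1 ih.property.1 ih.property.2 (upos (l.length + 1))
      exact ⟨(h1 _ _ _).1, (h1 _ _ _).2.1⟩
  let D : List Bool → Set α := fun l => (DP l).val
  have hne : ∀ l, (D l).Nonempty := fun l => by
    rw [Set.nonempty_iff_ne_empty]
    intro h
    apply (DP l).property.2
    change (f '' D l).Countable
    simp [h]
  have hanti : ClosureAntitone D := by
    refine Antitone.closureAntitone ?_ fun l => (DP l).property.1
    intro l a
    cases a
    · exact (h0 _ _ _).2.2.1
    exact (h1 _ _ _).2.2.1
  have hdiam : VanishingDiam D := by
    intro x
    apply tendsto_of_tendsto_of_tendsto_of_le_of_le' tendsto_const_nhds hu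
    · simp
    rw [Filter.eventually_atTop]
    refine ⟨1, fun m (hm : 1 ≤ m) => ?_⟩
    rw [Nat.one_le_iff_ne_zero] at hm
    rcases Nat.exists_eq_succ_of_ne_zero hm with ⟨n, rfl⟩
    dsimp
    cases x n
    · convert! (h0 _ _ _).2.2.2
      rw [PiNat.res_length]
    convert! (h1 _ _ _).2.2.2
    rw [PiNat.res_length]
  have hdisj' : ∀ l a b, a ≠ b → Disjoint (f '' D (a :: l)) (f '' D (b :: l)) := by
    rintro l (a | a) (b | b) hab <;> try contradiction
    · exact hdisj _ _ _
    exact (hdisj _ _ _).symm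
  have hdom : ∀ {x : ℕ → Bool}, x ∈ (inducedMap D).1 := fun {x} => by
    rw [hanti.map_of_vanishingDiam hdiam hne]
    apply Set.mem_univ
  refine ⟨fun x => (inducedMap D).2 ⟨x, hdom⟩, fun x y hxy => ?_⟩
  by_contra hne
  have hmem : ∀ z : ℕ → Bool, ∀ n, (inducedMap D).2 ⟨z, hdom⟩ ∈ D (z n :: PiNat.res z n) :=
    fun z n => map_mem (A := D) ⟨z, hdom⟩ (n + 1)
  have hres : PiNat.res x (PiNat.firstDiff x y) = PiNat.res y (PiNat.firstDiff x y) :=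
    PiNat.res_eq_res.2 fun _ hm => PiNat.apply_eq_of_lt_firstDiff hm
  have hy := hmem y (PiNat.firstDiff x y)
  rw [← hres] at hy
  exact Set.disjoint_left.1 (hdisj' _ _ _ (PiNat.apply_firstDiff_ne hne))
    (Set.mem_image_of_mem f (hmem x _)) ⟨_, hy, hxy.symm⟩

/-- A measurable map between standard Borel spaces either is injective on a copy of the Cantor set,
or its fibres are those of a measurable map to `ℕ`. -/
theorem Measurable.exists_injective_or_exists_nat {α β : Type*} [MeasurableSpace α]
    [StandardBorelSpace α] [MeasurableSpace β] [StandardBorelSpace β] {g : α → β}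
    (hg : Measurable g) :
    (∃ φ : (ℕ → Bool) → α, Function.Injective (g ∘ φ)) ∨
      ∃ h : α → ℕ, Measurable h ∧ ∀ x y, h x = h y ↔ g x = g y := by
  by_cases hc : (Set.range g).Countable
  · right
    have := hc.to_subtype
    obtain ⟨e, he⟩ := exists_injective_nat (Set.range g)
    refine ⟨fun x => e ⟨g x, x, rfl⟩, ?_, fun x y => ?_⟩
    · refine measurable_to_countable fun y => ?_
      convert! hg (measurableSet_singleton (g y)) using 1
      ext x
      simp [he.eq_iff, Subtype.ext_iff]
    · simp [he.eq_iff, Subtype.ext_iff]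
  · left
    let := upgradeStandardBorel α
    let := upgradeStandardBorel β
    obtain ⟨t', -, hcont, hpol⟩ := hg.exists_continuous
    exact @Continuous.exists_nat_bool_comp_injective α β t' hpol _ _ g hcont hc

section Bisimulation

open scoped Ordinal

variable {Y ι F : Type*}

/-- `R` is a back-and-forth relation for the moves `e`, preserving the predicates `p`. -/
def IsBisimulation (p : F → Y → Prop) (e : ι → Y → Y) (R : Y → Y → Prop) : Prop :=
  ∀ y z, R y z → (∀ a, p a y ↔ p a z) ∧
    (∀ i, ∃ j, R (e i y) (e j z)) ∧ ∀ j, ∃ i, R (e i y) (e j z)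

/-- The back-and-forth equivalence of rank `α`. -/
def BackForth (p : F → Y → Prop) (e : ι → Y → Y) (α : Ordinal.{0}) (y z : Y) : Prop :=
  (∀ a, p a y ↔ p a z) ∧ ∀ β, β < α →
    (∀ i, ∃ j, BackForth p e β (e i y) (e j z)) ∧ ∀ j, ∃ i, BackForth p e β (e i y) (e j z)
termination_by α

variable {p : F → Y → Prop} {e : ι → Y → Y}

theorem BackForth.mono {α β : Ordinal.{0}} (hβ : β ≤ α) {y z : Y} (h : BackForth p e α y z) :
    BackForth p e β y z := by
  rw [BackForth] at h ⊢
  exact ⟨h.1, fun γ hγ => h.2 γ (hγ.trans_le hβ)⟩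

theorem IsBisimulation.backForth {R : Y → Y → Prop} (hR : IsBisimulation p e R)
    (α : Ordinal.{0}) {y z : Y} (h : R y z) : BackForth p e α y z := by
  induction α using WellFoundedLT.induction generalizing y z with
  | _ α ih =>
    rw [BackForth]
    obtain ⟨hp, hf, hb⟩ := hR y z h
    exact ⟨hp, fun β hβ => ⟨fun i => (hf i).imp fun j hj => ih β hβ hj,
      fun j => (hb j).imp fun i hi => ih β hβ hi⟩⟩

theorem BackForth.equivalence (α : Ordinal.{0}) : Equivalence (BackForth p e α) := by
  induction α using WellFoundedLT.induction with
  | _ α ih =>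
    refine ⟨fun y => ?_, fun {y z} h => ?_, fun {x y z} h h' => ?_⟩
    · rw [BackForth]
      exact ⟨fun _ => Iff.rfl, fun β hβ =>
        ⟨fun i => ⟨i, (ih β hβ).refl _⟩, fun i => ⟨i, (ih β hβ).refl _⟩⟩⟩
    · rw [BackForth] at h ⊢
      exact ⟨fun a => (h.1 a).symm, fun β hβ =>
        ⟨fun i => ((h.2 β hβ).2 i).imp fun _ hj => (ih β hβ).symm hj,
          fun j => ((h.2 β hβ).1 j).imp fun _ hi => (ih β hβ).symm hi⟩⟩
    · rw [BackForth] at h h' ⊢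
      refine ⟨fun a => (h.1 a).trans (h'.1 a), fun β hβ => ⟨fun i => ?_, fun k => ?_⟩⟩
      · obtain ⟨j, hj⟩ := (h.2 β hβ).1 i
        obtain ⟨k, hk⟩ := (h'.2 β hβ).1 j
        exact ⟨k, (ih β hβ).trans hj hk⟩
      · obtain ⟨j, hj⟩ := (h'.2 β hβ).2 k
        obtain ⟨i, hi⟩ := (h.2 β hβ).2 j
        exact ⟨i, (ih β hβ).trans hi hj⟩

/-- If the back-and-forth ranks stabilize at `α` on the orbit of `y`, then equivalence of rank
`α + 2` with `y` already gives a bisimulation. -/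
theorem BackForth.exists_isBisimulation {α : Ordinal.{0}} {y z : Y}
    (hid : ∃ i, e i = id) (hcomp : ∀ i j, ∃ k, e k = e j ∘ e i)
    (hy : ∀ i j, BackForth p e α (e i y) (e j y) →
      BackForth p e (Order.succ α) (e i y) (e j y))
    (h : BackForth p e (Order.succ (Order.succ α)) y z) :
    ∃ R, IsBisimulation p e R ∧ R y z := by
  refine ⟨fun u v => BackForth p e α u v ∧ (∃ i, u = e i y) ∧ ∃ j, v = e j z, ?_,
    h.mono ((Order.le_succ α).trans (Order.le_succ _)), ?_⟩
  · rintro _ _ ⟨huv, ⟨i, rfl⟩, j, rfl⟩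
    have hsucc : BackForth p e (Order.succ α) (e i y) (e j z) := by
      rw [BackForth] at h
      obtain ⟨k, hk⟩ := (h.2 _ (Order.lt_succ _)).2 j
      have hik := (equivalence α).trans huv
        ((equivalence α).symm (hk.mono (Order.le_succ α)))
      exact (equivalence _).trans (hy i k hik) hk
    rw [BackForth] at hsucc
    obtain ⟨hf, hb⟩ := hsucc.2 α (Order.lt_succ α)
    refine ⟨hsucc.1, fun k => ?_, fun k => ?_⟩
    · obtain ⟨l, hl⟩ := hf k
      obtain ⟨m, hm⟩ := hcomp i k
      obtain ⟨n, hn⟩ := hcomp j l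
      exact ⟨l, hl, ⟨m, by rw [hm]; rfl⟩, n, by rw [hn]; rfl⟩
    · obtain ⟨l, hl⟩ := hb k
      obtain ⟨m, hm⟩ := hcomp i l
      obtain ⟨n, hn⟩ := hcomp j k
      exact ⟨l, hl, ⟨m, by rw [hm]; rfl⟩, n, by rw [hn]; rfl⟩
  · obtain ⟨i, hi⟩ := hid
    exact ⟨⟨i, by simp [hi]⟩, i, by simp [hi]⟩

/-- On each orbit the back-and-forth ranks stabilize at a countable ordinal. -/
theorem BackForth.exists_stable_rank [Countable ι] (p : F → Y → Prop) (e : ι → Y → Y) (y : Y) :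
    ∃ α < ω₁, ∀ i j, BackForth p e α (e i y) (e j y) →
      BackForth p e (Order.succ α) (e i y) (e j y) := by
  have hex : ∀ ij : ι × ι, ∃ α < ω₁, BackForth p e α (e ij.1 y) (e ij.2 y) →
      ∀ β < ω₁, BackForth p e β (e ij.1 y) (e ij.2 y) := by
    intro ij
    by_cases h : ∀ β < ω₁, BackForth p e β (e ij.1 y) (e ij.2 y)
    · exact ⟨0, (Cardinal.isSuccLimit_omega 1).bot_lt, fun _ => h⟩
    · push Not at h
      obtain ⟨β, hβ, h⟩ := h
      exact ⟨β, hβ, fun h' => absurd h' h⟩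
  choose a ha h using hex
  have hlt : ⨆ ij, a ij < ω₁ := Ordinal.iSup_lt_omega_one ha
  refine ⟨⨆ ij, a ij, hlt, fun i j hij => h (i, j) (hij.mono ?_) _ ?_⟩
  · exact le_ciSup (f := a) Ordinal.bddAbove_of_small (i, j)
  · exact (Cardinal.isSuccLimit_omega 1).succ_lt hlt

theorem BackForth.injective_or_nat [MeasurableSpace Y] [StandardBorelSpace Y] [Countable ι]
    [Countable F] (hp : ∀ a, Measurable (p a)) (he : ∀ i, Measurable (e i))
    {α : Ordinal.{0}} (hα : α < ω₁)
    (ih : ∀ β < α, ∃ h : Y → ℕ, Measurable h ∧ ∀ y z, h y = h z ↔ BackForth p e β y z) :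
    (∃ φ : (ℕ → Bool) → Y, ∀ x x', BackForth p e α (φ x) (φ x') → x = x') ∨
      ∃ h : Y → ℕ, Measurable h ∧ ∀ y z, h y = h z ↔ BackForth p e α y z := by
  have hcount : Countable (Set.Iio α) := by
    rw [← Cardinal.mk_le_aleph0_iff, Cardinal.mk_Iio_ordinal, Cardinal.lift_le_aleph0,
      ← Cardinal.lt_aleph_one_iff]
    exact Cardinal.lt_ord.1 (by simpa using hα)
  choose! h hm hh using ih
  let g : Y → F ⊕ Set.Iio α × ℕ → Prop := fun y =>
    Sum.elim (fun a => p a y) fun b => ∃ i, h b.1 (e i y) = b.2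
  have hg : Measurable g := by
    refine measurable_pi_iff.2 ?_
    rintro (a | ⟨⟨β, hβ⟩, n⟩)
    · exact hp a
    · exact Measurable.exists fun i => ((hm β hβ).comp (he i)).eq measurable_const
  have hgE : ∀ y z, g y = g z ↔ BackForth p e α y z := by
    intro y z
    rw [BackForth, funext_iff, Sum.forall]
    refine and_congr (by simp [g]) ⟨fun H β hβ => ⟨fun i => ?_, fun j => ?_⟩, ?_⟩
    · obtain ⟨j, hj⟩ := (H (⟨β, hβ⟩, h β (e i y))).mp ⟨i, rfl⟩
      exact ⟨j, (hh β hβ _ _).1 hj.symm⟩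
    · obtain ⟨i, hi⟩ := (H (⟨β, hβ⟩, h β (e j z))).mpr ⟨j, rfl⟩
      exact ⟨i, (hh β hβ _ _).1 hi⟩
    · rintro H ⟨⟨β, hβ⟩, n⟩
      obtain ⟨hf, hb⟩ := H β hβ
      refine propext ⟨?_, ?_⟩
      · rintro ⟨i, hi⟩
        obtain ⟨j, hj⟩ := hf i
        exact ⟨j, ((hh β hβ _ _).2 hj).symm.trans hi⟩
      · rintro ⟨j, hj⟩
        obtain ⟨i, hi⟩ := hb j
        exact ⟨i, ((hh β hβ _ _).2 hi).trans hj⟩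
  rcases hg.exists_injective_or_exists_nat with ⟨φ, hφ⟩ | ⟨k, hk, hkg⟩
  · exact Or.inl ⟨φ, fun x x' hx => hφ ((hgE _ _).2 hx)⟩
  · exact Or.inr ⟨k, hk, fun y z => (hkg y z).trans (hgE y z)⟩

/-- Up to bisimilarity, a standard Borel space with countably many measurable moves either contains
a copy of the Cantor set, or has at most `ℵ₁` points. -/
theorem exists_cantor_or_exists_code [MeasurableSpace Y] [StandardBorelSpace Y] [Countable ι]
    [Countable F] (hp : ∀ a, Measurable (p a)) (he : ∀ i, Measurable (e i))
    (hid : ∃ i, e i = id) (hcomp : ∀ i j, ∃ k, e k = e j ∘ e i) :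
    (∃ φ : (ℕ → Bool) → Y, ∀ x x' R, IsBisimulation p e R → R (φ x) (φ x') → x = x') ∨
      ∃ c : Y → Set.Iio (ω₁ : Ordinal.{0}) × ℕ, ∀ y z, c y = c z →
        ∃ R, IsBisimulation p e R ∧ R y z := by
  by_cases H : ∃ α : Ordinal.{0}, ∃ φ : (ℕ → Bool) → Y,
      ∀ x x', BackForth p e α (φ x) (φ x') → x = x'
  · obtain ⟨α, φ, hφ⟩ := H
    exact Or.inl ⟨φ, fun x x' R hR h => hφ x x' (hR.backForth α h)⟩
  · right
    push Not at H
    have hnat : ∀ α < ω₁, ∃ h : Y → ℕ, Measurable h ∧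
        ∀ y z, h y = h z ↔ BackForth p e α y z := by
      intro α
      induction α using WellFoundedLT.induction with
      | _ α ih =>
        intro hα
        refine (BackForth.injective_or_nat hp he hα
          fun β hβ => ih β hβ (hβ.trans hα)).resolve_left ?_
        rintro ⟨φ, hφ⟩
        obtain ⟨x, x', hx, hne⟩ := H α φ
        exact hne (hφ x x' hx)
    choose! h _ hh using hnat
    choose a ha hstable using BackForth.exists_stable_rank p e
    refine ⟨fun y => (⟨a y, ha y⟩, h (Order.succ (Order.succ (a y))) y), fun y z hyz => ?_⟩
    have h₁ : a y = a z := congrArg (fun c => c.1.1) hyz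
    have h₂ := congrArg Prod.snd hyz
    simp only [← h₁] at h₂
    have hlim := Cardinal.isSuccLimit_omega 1
    exact BackForth.exists_isBisimulation hid hcomp (hstable y)
      ((hh _ (hlim.succ_lt (hlim.succ_lt (ha y))) _ _).1 h₂)

end Bisimulation

namespace FirstOrder.Language

variable (L : Language)

/-- Codes for `L`-structures with universe `ℕ`. -/
abbrev StructureCode : Type _ :=
  ((Σ f : Σ n, L.Functions n, Fin f.1 → ℕ) → ℕ) × ((Σ r : Σ n, L.Relations n, Fin r.1 → ℕ) → Prop)

variable {L}

/-- The structure on `ℕ` with a given code. -/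
abbrev StructureCode.toStructure (c : L.StructureCode) : L.Structure ℕ where
  funMap f x := c.1 ⟨⟨_, f⟩, x⟩
  RelMap r x := c.2 ⟨⟨_, r⟩, x⟩

/-- The code of a structure on `ℕ`. -/
def StructureCode.ofStructure (S : L.Structure ℕ) : L.StructureCode :=
  (fun f => S.funMap f.1.2 f.2, fun r => S.RelMap r.1.2 r.2)

/-- The permutation `e` of `ℕ` is an isomorphism from `S` to `S'`. -/
def IsStructureIso (S S' : L.Structure ℕ) (e : ℕ ≃ ℕ) : Prop :=
  (∀ n (f : L.Functions n) x, e (S.funMap f x) = S'.funMap f (e ∘ x)) ∧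
    ∀ n (r : L.Relations n) x, S'.RelMap r (e ∘ x) ↔ S.RelMap r x

theorem nonempty_equiv_iff_exists_isStructureIso {S S' : L.Structure ℕ} :
    Nonempty (@Language.Equiv L ℕ ℕ S S') ↔ ∃ e, IsStructureIso S S' e :=
  ⟨fun ⟨g⟩ => ⟨@Equiv.toEquiv L ℕ ℕ S S' g, fun _ => @Equiv.map_fun' L ℕ ℕ S S' g _,
      fun _ => @Equiv.map_rel' L ℕ ℕ S S' g _⟩,
    fun ⟨e, hf, hr⟩ => ⟨@Equiv.mk L ℕ ℕ S S' e (fun {n} => hf n) fun {n} => hr n⟩⟩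

theorem IsStructureIso.symm {S S' : L.Structure ℕ} {e : ℕ ≃ ℕ} (h : IsStructureIso S S' e) :
    IsStructureIso S' S e.symm := by
  refine ⟨fun n f x => ?_, fun n r x => ?_⟩
  · rw [Equiv.symm_apply_eq, h.1, ← Function.comp_assoc, _root_.Equiv.self_comp_symm,
      Function.id_comp]
  · rw [← h.2, ← Function.comp_assoc, _root_.Equiv.self_comp_symm,
      Function.id_comp]

theorem IsStructureIso.trans {S S' S'' : L.Structure ℕ} {e e' : ℕ ≃ ℕ}
    (h : IsStructureIso S S' e) (h' : IsStructureIso S' S'' e') :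
    IsStructureIso S S'' (e.trans e') :=
  ⟨fun n f x => by simp [h.1, h'.1, Function.comp_assoc],
    fun n r x => by rw [← h.2, ← h'.2, Equiv.coe_trans, Function.comp_assoc]⟩

theorem countable_relations_of_countable_symbols [h : Countable L.Symbols] :
    Countable (Σ n, L.Relations n) :=
  Function.Injective.countable (β := L.Symbols) Sum.inr_injective

section Measurable

theorem measurable_term_realize {α : Type*} (t : L.Term α) (v : α → ℕ) :
    Measurable fun c : L.StructureCode => @Term.realize L ℕ c.toStructure α v t := by
  induction t with
  | var a => exact measurable_const
  | func f ts ih =>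
    have h : Measurable fun q : L.StructureCode × (Fin _ → ℕ) => q.1.1 ⟨⟨_, f⟩, q.2⟩ :=
      measurable_from_prod_countable_left fun x =>
        (measurable_pi_apply (⟨⟨_, f⟩, x⟩ : Σ f : Σ n, L.Functions n, Fin f.1 → ℕ)).comp
          measurable_fst
    exact h.comp (measurable_id.prodMk (measurable_pi_lambda _ ih))

theorem measurable_boundedFormula_realize {α : Type*} {n : ℕ} (φ : L.BoundedFormula α n)
    (v : α → ℕ) (xs : Fin n → ℕ) :
    Measurable fun c : L.StructureCode =>
      @BoundedFormula.Realize L ℕ c.toStructure α n φ v xs := by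
  induction φ with
  | falsum => exact measurable_const
  | equal t₁ t₂ =>
    exact (measurable_term_realize t₁ _).eq (measurable_term_realize t₂ _)
  | rel r ts =>
    have h : Measurable fun q : L.StructureCode × (Fin _ → ℕ) => q.1.2 ⟨⟨_, r⟩, q.2⟩ :=
      measurable_from_prod_countable_left fun x =>
        (measurable_pi_apply (⟨⟨_, r⟩, x⟩ : Σ r : Σ n, L.Relations n, Fin r.1 → ℕ)).comp
          measurable_snd
    exact h.comp (measurable_id.prodMk
      (measurable_pi_lambda _ fun i => measurable_term_realize (ts i) _))
  | imp φ ψ ihφ ihψ => exact (ihφ xs).imp (ihψ xs)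
  | all φ ih => exact Measurable.forall fun x => ih (Fin.snoc xs x)

/-- The codes of models of a theory. -/
abbrev ModelCode (T : L.Theory) : Type _ :=
  {c : L.StructureCode // @Theory.Model L ℕ c.toStructure T}

instance [Countable L.Symbols] (T : L.Theory) : StandardBorelSpace (ModelCode T) := by
  have := countable_relations_of_countable_symbols (L := L)
  have : Countable L.Sentence := inferInstanceAs (Countable (L.Formula Empty))
  have hm : Measurable fun c : L.StructureCode => @Theory.Model L ℕ c.toStructure T := by
    simp only [Theory.model_iff]
    exact Measurable.forall fun φ => measurable_const.imp
      (measurable_boundedFormula_realize φ _ _)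
  exact MeasurableSet.standardBorel hm.setOf

end Measurable

/-- The atomic facts about a finite tuple: its length, equality of entries, relations and
function values. -/
abbrev TupleFact (L : Language) : Type _ :=
  (ℕ ⊕ ℕ × ℕ) ⊕ (Σ r : Σ n, L.Relations n, Fin r.1 → ℕ) ⊕
    (Σ f : Σ n, L.Functions n, Fin f.1 → ℕ) × ℕ

/-- The atomic fact holds at the tuple `s` of the structure `S`. -/
def TupleFact.Holds (S : L.Structure ℕ) (s : List ℕ) : L.TupleFact → Prop
  | .inl (.inl n) => s.length = n
  | .inl (.inr (i, j)) => s[i]? = s[j]?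
  | .inr (.inl ⟨r, x⟩) => ∃ v, (∀ i, s[x i]? = some (v i)) ∧ S.RelMap r.2 v
  | .inr (.inr (⟨f, x⟩, j)) => ∃ v, (∀ i, s[x i]? = some (v i)) ∧ s[j]? = some (S.funMap f.2 v)

instance : MeasurableSpace (List ℕ) := ⊤

instance : DiscreteMeasurableSpace (List ℕ) := ⟨fun _ => trivial⟩

variable {T : L.Theory}

/-- An atomic fact as a predicate on pairs of a model and a tuple. -/
def TupleFact.On (a : L.TupleFact) (y : ModelCode T × List ℕ) : Prop :=
  a.Holds y.1.1.toStructure y.2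

/-- Extending the tuple in a pair of a model and a tuple. -/
def extendTuple (t : List ℕ) (y : ModelCode T × List ℕ) : ModelCode T × List ℕ :=
  (y.1, y.2 ++ t)

theorem TupleFact.measurable_on (a : L.TupleFact) :
    Measurable (TupleFact.On a : ModelCode T × List ℕ → Prop) := by
  refine measurable_from_prod_countable_left fun s => ?_
  rcases a with (n | ⟨i, j⟩) | ⟨r, x⟩ | ⟨⟨f, x⟩, j⟩
  · exact measurable_const (a := s.length = n)
  · exact measurable_const (a := s[i]? = s[j]?)
  · exact Measurable.exists fun v =>
      (measurable_const (a := ∀ i, s[x i]? = some (v i))).and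
      ((measurable_pi_apply (⟨r, v⟩ : Σ r : Σ n, L.Relations n, Fin r.1 → ℕ)).comp
        (measurable_snd.comp measurable_subtype_coe))
  · have h : Measurable fun n : ℕ => s[j]? = some n := Measurable.of_discrete
    exact Measurable.exists fun v =>
      (measurable_const (a := ∀ i, s[x i]? = some (v i))).and (h.comp
      ((measurable_pi_apply (⟨f, v⟩ : Σ f : Σ n, L.Functions n, Fin f.1 → ℕ)).comp
        (measurable_fst.comp measurable_subtype_coe)))

theorem measurable_extendTuple (t : List ℕ) :
    Measurable (extendTuple t : ModelCode T × List ℕ → ModelCode T × List ℕ) :=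
  measurable_fst.prodMk
    ((Measurable.of_discrete (f := fun s : List ℕ => s ++ t)).comp measurable_snd)

/-- An isomorphism preserves the atomic facts. -/
theorem TupleFact.holds_map {S S' : L.Structure ℕ} {g : ℕ ≃ ℕ} (hiso : IsStructureIso S S' g)
    (s : List ℕ) (a : L.TupleFact) : a.Holds S s ↔ a.Holds S' (s.map g) := by
  have hg : ∀ {k : ℕ} {x v : Fin k → ℕ}, (∀ i, s[x i]? = some (v i)) →
      ∀ i, (s.map g)[x i]? = some (g (v i)) := fun h i => by simp [h i]
  have hg' : ∀ {k : ℕ} {x v : Fin k → ℕ}, (∀ i, (s.map g)[x i]? = some (v i)) →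
      ∃ w : Fin k → ℕ, (∀ i, s[x i]? = some (w i)) ∧ v = g ∘ w := fun {k x v} h => by
    simp only [List.getElem?_map, Option.map_eq_some_iff] at h
    choose w hw hwv using h
    exact ⟨w, hw, funext fun i => (hwv i).symm⟩
  rcases a with (n | ⟨i, j⟩) | ⟨r, x⟩ | ⟨⟨f, x⟩, j⟩
  · simp [Holds]
  · simp [Holds, (Option.map_injective g.injective).eq_iff]
  · constructor
    · rintro ⟨v, hv, h⟩
      exact ⟨_, hg hv, (hiso.2 _ r.2 v).2 h⟩
    · rintro ⟨v, hv, h⟩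
      obtain ⟨w, hw, rfl⟩ := hg' hv
      exact ⟨w, hw, (hiso.2 _ r.2 w).1 h⟩
  · constructor
    · rintro ⟨v, hv, h⟩
      refine ⟨_, hg hv, ?_⟩
      rw [List.getElem?_map, h]
      exact congrArg some (hiso.1 _ f.2 v)
    · rintro ⟨v, hv, h⟩
      obtain ⟨w, hw, rfl⟩ := hg' hv
      refine ⟨w, hw, Option.map_injective g.injective ?_⟩
      rw [← List.getElem?_map, h]
      exact congrArg some (hiso.1 _ f.2 w).symm

theorem isBisimulation_iso : IsBisimulation (TupleFact.On (T := T)) extendTuple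
    fun y z => ∃ g, IsStructureIso y.1.1.toStructure z.1.1.toStructure g ∧
      z.2 = y.2.map g := by
  rintro ⟨c, s⟩ ⟨c', _⟩ ⟨g, hg, rfl⟩
  refine ⟨TupleFact.holds_map hg s, fun t => ⟨t.map g, g, hg, ?_⟩,
    fun t => ⟨t.map g.symm, g, hg, ?_⟩⟩
  · simp [extendTuple]
  · simp [extendTuple, Function.comp_def]

/-- A coherent sequence of pairs of tuples with the same atomic facts, exhausting both structures,
induces an isomorphism. -/
theorem nonempty_equiv_of_holds_iff {S S' : L.Structure ℕ} (q : ℕ → List ℕ × List ℕ)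
    (hq : ∀ k (a : L.TupleFact), a.Holds S (q k).1 ↔ a.Holds S' (q k).2)
    (hl : ∀ m, ∃ i n k₀ : ℕ, ∀ k ≥ k₀, (q k).1[i]? = some m ∧ (q k).2[i]? = some n)
    (hr : ∀ n, ∃ i m k₀ : ℕ, ∀ k ≥ k₀, (q k).1[i]? = some m ∧ (q k).2[i]? = some n) :
    Nonempty (@Language.Equiv L ℕ ℕ S S') := by
  choose I g N hN using hl
  choose I' g' N' hN' using hr
  have hev : ∀ m, ∀ᶠ k in Filter.atTop, (q k).1[I m]? = some m ∧ (q k).2[I m]? = some (g m) :=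
    fun m => Filter.eventually_atTop.2 ⟨N m, hN m⟩
  have hev' : ∀ n, ∀ᶠ k in Filter.atTop,
      (q k).1[I' n]? = some (g' n) ∧ (q k).2[I' n]? = some n :=
    fun n => Filter.eventually_atTop.2 ⟨N' n, hN' n⟩
  have hinv : Function.LeftInverse g' g := fun m => by
    obtain ⟨k, ⟨h₁, h₂⟩, h₃, h₄⟩ := ((hev m).and (hev' (g m))).exists
    have := (hq k (.inl (.inr (I m, I' (g m))))).2 (h₂.trans h₄.symm)
    exact Option.some_injective _ (h₃.symm.trans (this.symm.trans h₁))
  have hinv' : Function.RightInverse g' g := fun n => by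
    obtain ⟨k, ⟨h₁, h₂⟩, h₃, h₄⟩ := ((hev (g' n)).and (hev' n)).exists
    have := (hq k (.inl (.inr (I (g' n), I' n)))).1 (h₁.trans h₃.symm)
    exact Option.some_injective _ (h₂.symm.trans (this.trans h₄))
  refine nonempty_equiv_iff_exists_isStructureIso.2 ⟨⟨g, g', hinv, hinv'⟩, ?_, ?_⟩
  · intro n f x
    obtain ⟨k, h, h₁, h₂⟩ := ((Filter.eventually_all.2 fun i => hev (x i)).and
      (hev (S.funMap f x))).exists
    obtain ⟨v, hv, hf⟩ := (hq k (.inr (.inr (⟨⟨n, f⟩, I ∘ x⟩, I (S.funMap f x))))).1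
      ⟨x, fun i => (h i).1, h₁⟩
    obtain rfl : v = g ∘ x := funext fun i =>
      Option.some_injective _ ((hv i).symm.trans (h i).2)
    exact Option.some_injective _ (h₂.symm.trans hf)
  · intro n r x
    obtain ⟨k, h⟩ := (Filter.eventually_all.2 fun i => hev (x i)).exists
    constructor
    · intro hrel
      obtain ⟨v, hv, hr⟩ := (hq k (.inr (.inl ⟨⟨n, r⟩, I ∘ x⟩))).2
        ⟨g ∘ x, fun i => (h i).2, hrel⟩
      obtain rfl : v = x := funext fun i =>
        Option.some_injective _ ((hv i).symm.trans (h i).1)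
      exact hr
    · intro hrel
      obtain ⟨v, hv, hr⟩ := (hq k (.inr (.inl ⟨⟨n, r⟩, I ∘ x⟩))).1 ⟨x, fun i => (h i).1, hrel⟩
      obtain rfl : v = g ∘ x := funext fun i =>
        Option.some_injective _ ((hv i).symm.trans (h i).2)
      exact hr

theorem nonempty_equiv_of_isBisimulation {R : ModelCode T × List ℕ → ModelCode T × List ℕ → Prop}
    (hR : IsBisimulation TupleFact.On extendTuple R) {c c' : ModelCode T}
    (h : R (c, []) (c', [])) :
    Nonempty (@Language.Equiv L ℕ ℕ c.1.toStructure c'.1.toStructure) := by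
  have hlen : ∀ {s s'}, R (c, s) (c', s') → s'.length = s.length := fun {s s'} h =>
    ((hR _ _ h).1 (.inl (.inl s.length))).1 rfl
  have hl : ∀ (s : {s : List ℕ × List ℕ // R (c, s.1) (c', s.2)}) (m : ℕ),
      ∃ n, R (c, s.1.1 ++ [m]) (c', s.1.2 ++ [n]) := by
    rintro ⟨⟨s, s'⟩, h⟩ m
    obtain ⟨t, ht⟩ := (hR _ _ h).2.1 [m]
    have h₁ := hlen h
    have h₂ := hlen ht
    simp only [List.length_append, h₁, List.length_singleton, add_right_inj] at h₂
    obtain ⟨n, rfl⟩ := List.length_eq_one_iff.1 h₂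
    exact ⟨n, ht⟩
  have hr : ∀ (s : {s : List ℕ × List ℕ // R (c, s.1) (c', s.2)}) (n : ℕ),
      ∃ m, R (c, s.1.1 ++ [m]) (c', s.1.2 ++ [n]) := by
    rintro ⟨⟨s, s'⟩, h⟩ n
    obtain ⟨t, ht⟩ := (hR _ _ h).2.2 [n]
    have h₁ := hlen h
    have h₂ := hlen ht
    simp only [List.length_append, h₁, List.length_singleton, add_right_inj] at h₂
    obtain ⟨m, rfl⟩ := List.length_eq_one_iff.1 h₂.symm
    exact ⟨m, ht⟩
  choose f hf using hl
  choose b hb using hr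
  let fwd (s : {s : List ℕ × List ℕ // R (c, s.1) (c', s.2)}) (m : ℕ) :
      {s : List ℕ × List ℕ // R (c, s.1) (c', s.2)} := ⟨(s.1.1 ++ [m], s.1.2 ++ [f s m]), hf s m⟩
  let bwd (s : {s : List ℕ × List ℕ // R (c, s.1) (c', s.2)}) (n : ℕ) :
      {s : List ℕ × List ℕ // R (c, s.1) (c', s.2)} := ⟨(s.1.1 ++ [b s n], s.1.2 ++ [n]), hb s n⟩
  let q : ℕ → {s : List ℕ × List ℕ // R (c, s.1) (c', s.2)} :=
    Nat.rec ⟨([], []), h⟩ fun k s => bwd (fwd s k) k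
  have hq : ∀ k, (q (k + 1)).1 = ((q k).1.1 ++ [k] ++ [b (fwd (q k) k) k],
    (q k).1.2 ++ [f (q k) k] ++ [k]) := fun k => rfl
  have hmono : ∀ {k₀ k i m n : ℕ}, k₀ ≤ k → (q k₀).1.1[i]? = some m ∧ (q k₀).1.2[i]? = some n →
      (q k).1.1[i]? = some m ∧ (q k).1.2[i]? = some n := by
    intro k₀ k i m n hk h₀
    induction k, hk using Nat.le_induction with
    | base => exact h₀
    | succ k _ ih =>
      have h₁ := (List.getElem?_eq_some_iff.1 ih.1).1
      have h₂ := (List.getElem?_eq_some_iff.1 ih.2).1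
      simp only [hq, List.append_assoc]
      rw [List.getElem?_append_left h₁, List.getElem?_append_left h₂]
      exact ih
  refine nonempty_equiv_of_holds_iff (fun k => (q k).1) (fun k => (hR _ _ (q k).2).1)
    (fun m => ⟨(q m).1.1.length, f (q m) m, m + 1, fun k hk => hmono hk ?_⟩)
    (fun n => ⟨(q n).1.1.length + 1, b (fwd (q n) n) n, n + 1, fun k hk => hmono hk ?_⟩)
  · have := hlen (q m).2
    simp [hq, ← this]
  · have := hlen (q n).2
    simp [hq, ← this]

end FirstOrder.Language

/-- Morley's theorem on the number of countable models: for a countable first-order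
language `L` and an `L`-theory `T`, the number of isomorphism classes of models of `T`
with underlying set `ℕ` is at most `ℵ₁` or exactly `2^ℵ₀`. -/
theorem absolute_morley (L : Language) [Countable L.Symbols] (T : L.Theory) :
    #(Quotient (countableModelSetoid L T)) ≤ aleph 1 ∨
      #(Quotient (countableModelSetoid L T)) = continuum := by
  have := Language.countable_relations_of_countable_symbols (L := L)
  let code (q : Quotient (countableModelSetoid L T)) : Language.ModelCode T :=
    ⟨Language.StructureCode.ofStructure q.out.1, q.out.2⟩
  have hcode : ∀ q q', Nonempty (@Language.Equiv L ℕ ℕ (code q).1.toStructure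
      (code q').1.toStructure) → q = q' := fun q q' h => by
    rw [← q.out_eq, ← q'.out_eq]
    exact Quotient.sound h
  rcases exists_cantor_or_exists_code (Language.TupleFact.measurable_on (T := T))
    Language.measurable_extendTuple ⟨[], funext fun y => by simp [Language.extendTuple]⟩
    (fun s t => ⟨s ++ t, funext fun y => by simp [Language.extendTuple]⟩) with ⟨φ, hφ⟩ | ⟨c, hc⟩
  · right
    apply le_antisymm
    · have hinj : Function.Injective fun q => MeasureTheory.embeddingReal _ (code q) :=
        (MeasureTheory.measurableEmbedding_embeddingReal _).injective.comp fun q q' h =>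
          hcode q q' (h ▸ ⟨@Language.Equiv.refl L ℕ (code q).1.toStructure⟩)
      simpa [mk_real] using lift_mk_le_lift_mk_of_injective hinj
    · have hrep : ∀ y : Language.ModelCode T × List ℕ, ∃ q,
          Nonempty (@Language.Equiv L ℕ ℕ (code q).1.toStructure y.1.1.toStructure) := fun y =>
        ⟨Quotient.mk (countableModelSetoid L T) ⟨y.1.1.toStructure, y.1.2⟩,
          Quotient.mk_out (s := countableModelSetoid L T) ⟨y.1.1.toStructure, y.1.2⟩⟩
      simp only [Language.nonempty_equiv_iff_exists_isStructureIso] at hrep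
      choose q g hg using hrep
      have hinj : Function.Injective fun x =>
          (q (φ x), (φ x).2.map (g (φ x)).symm) := by
        intro x x' h
        obtain ⟨h₁, h₂⟩ := Prod.mk.inj h
        refine hφ x x' _ Language.isBisimulation_iso
          ⟨(g (φ x)).symm.trans (g (φ x')), (hg (φ x)).symm.trans ?_, ?_⟩
        · rw [h₁]
          exact hg (φ x')
        · rw [Equiv.coe_trans, ← List.map_map, h₂]
          simp [Function.comp_def]
      have hle := lift_mk_le_lift_mk_of_injective hinj
      simp only [mk_prod, mk_arrow, mk_bool, mk_nat, lift_aleph0, two_power_aleph0,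
        mk_eq_aleph0 (List ℕ), lift_id, lift_id', lift_continuum] at hle
      by_contra! hlt
      exact (hle.trans_lt (mul_lt_of_lt aleph0_le_continuum (by simpa using hlt)
        aleph0_lt_continuum)).false
  · left
    have hinj : Function.Injective fun q => c (code q, []) := fun q q' h => by
      obtain ⟨R, hR, h⟩ := hc _ _ h
      exact hcode q q' (Language.nonempty_equiv_of_isBisimulation hR h)
    have hle := lift_mk_le_lift_mk_of_injective hinj
    rw [mk_prod, mk_Iio_ordinal] at hle
    simpa using hle
end

section
/- Let E be an equivalence relation on ℝ such that the set {(x, y) ∈ ℝ × ℝ : x E y} is an analytic subset of ℝ × ℝ. If there is no nonempty perfect set P ⊆ ℝ whose elements are pairwise E-inequivalent (i.e., no nonempty perfect P such that any two distinct elements of P are E-inequivalent), then E has at most ℵ₁ equivalence classes, i.e., the cardinality of the quotient ℝ/E is at most ℵ₁. -/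
open Cardinal

section Burgess

open Set Filter Topology PiNat
open TopologicalSpace (generateFrom)

/-- If the point `z` lies in the closure of the image of every cylinder along a branch `x`,
then `f x = z`. -/
theorem eq_of_forall_mem_closure_image {Z : Type*} [TopologicalSpace Z] [T2Space Z]
    {f : (ℕ → ℕ) → Z} (hf : Continuous f) {x : ℕ → ℕ} {z : Z}
    (h : ∀ n, z ∈ closure (f '' cylinder x n)) : f x = z := by
  by_contra hne
  obtain ⟨U, V, hU, hV, hxU, hzV, hUV⟩ := t2_separation hne
  have hU' : f ⁻¹' U ∈ 𝓝 x := hf.continuousAt.preimage_mem_nhds (hU.mem_nhds hxU)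
  obtain ⟨n, hn⟩ : ∃ n, cylinder x n ⊆ f ⁻¹' U := by
    obtain ⟨_, ⟨y, n, rfl⟩, hy, hn⟩ :=
      (isTopologicalBasis_cylinders (fun _ : ℕ => ℕ)).mem_nhds_iff.1 hU'
    exact ⟨n, by rwa [mem_cylinder_iff_eq.1 hy]⟩
  obtain ⟨_, hfV, y, hy, rfl⟩ := mem_closure_iff.1 (h n) V hV hzV
  exact hUV.le_bot ⟨hn hy, hfV⟩

/-- A sequence of lists, each extending the previous one by one entry, comes from a branch. -/
theorem exists_res_of_forall_exists_cons {P : List ℕ → Prop} (h0 : P [])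
    (h : ∀ s, P s → ∃ n, P (n :: s)) : ∃ x : ℕ → ℕ, ∀ n, P (res x n) := by
  choose g hg using h
  let u : ℕ → {s // P s} := fun n => Nat.rec ⟨[], h0⟩ (fun _ s => ⟨g s.1 s.2 :: s.1, hg s.1 s.2⟩) n
  let x : ℕ → ℕ := fun n => g (u n).1 (u n).2
  refine ⟨x, fun n => ?_⟩
  have : res x n = (u n).1 := by
    induction n with
    | zero => rfl
    | succ n ih => rw [res_succ, ih]
  rw [this]
  exact (u n).2

/-- The basic clopen set of sequences whose initial segment (in reverse order) is `s`. -/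
def listCylinder (s : List ℕ) : Set (ℕ → ℕ) := {x | res x s.length = s}

theorem listCylinder_res (x : ℕ → ℕ) (n : ℕ) : listCylinder (res x n) = cylinder x n := by
  rw [cylinder_eq_res, listCylinder, res_length]

theorem listCylinder_nil : listCylinder [] = Set.univ := by
  simp [listCylinder]

theorem listCylinder_eq_iUnion (s : List ℕ) : listCylinder s = ⋃ n, listCylinder (n :: s) := by
  ext x
  simp [listCylinder]

/-- A nonmeagre analytic set is comeagre in some nonempty open set. -/
theorem MeasureTheory.AnalyticSet.exists_isOpen_isMeagre_diff {Z : Type*} [TopologicalSpace Z]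
    [PolishSpace Z] {S : Set Z} (hS : MeasureTheory.AnalyticSet S) (hS' : ¬ IsMeagre S) :
    ∃ O : Set Z, IsOpen O ∧ O.Nonempty ∧ IsMeagre (O \ S) := by
  borelize Z
  rw [MeasureTheory.AnalyticSet] at hS
  rcases hS with rfl | ⟨f, hf, rfl⟩
  · exact absurd IsMeagre.empty hS'
  set A : List ℕ → Set Z := fun s => f '' listCylinder s with hA
  have hA' (s) : A s = ⋃ n, A (n :: s) := by
    simp only [hA]
    rw [listCylinder_eq_iUnion, image_iUnion]
  set K : List ℕ → Set Z := fun s => {z | ∀ O, IsOpen O → z ∈ O → ¬ IsMeagre (A s ∩ O)} with hK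
  have hKclosed (s) : IsClosed (K s) := by
    rw [← isOpen_compl_iff, isOpen_iff_forall_mem_open]
    intro z hz
    simp only [hK, mem_compl_iff, mem_ofPred, not_forall, not_not] at hz
    obtain ⟨O, hO, hzO, hm⟩ := hz
    exact ⟨O, fun y hy hyK => hyK O hO hy hm, hO, hzO⟩
  have hAK (s) : IsMeagre (A s \ K s) := by
    have hcb := TopologicalSpace.countable_countableBasis Z
    refine IsMeagre.mono (s := ⋃ B ∈ {B ∈ TopologicalSpace.countableBasis Z | IsMeagre (A s ∩ B)},
      A s ∩ B) ?_ (isMeagre_biUnion (hcb.mono (sep_subset _ _)) fun B hB => hB.2)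
    rintro z ⟨hzA, hzK⟩
    simp only [hK, mem_ofPred, not_forall, not_not] at hzK
    obtain ⟨O, hO, hzO, hm⟩ := hzK
    obtain ⟨B, hB, hzB, hBO⟩ :=
      (TopologicalSpace.isBasis_countableBasis Z).exists_subset_of_mem_open hzO hO
    exact mem_biUnion (⟨hB, hm.mono (inter_subset_inter_right _ hBO)⟩) ⟨hzA, hzB⟩
  have hL (s) : IsMeagre (K s \ ⋃ n, K (n :: s)) := by
    by_contra hL
    have hmeas : MeasurableSet (K s \ ⋃ n, K (n :: s)) :=
      (hKclosed s).measurableSet.diff (.iUnion fun n => (hKclosed _).measurableSet)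
    obtain ⟨O, hO, hLO⟩ := hmeas.residualEq_isOpen
    have hOL : IsMeagre (O \ (K s \ ⋃ n, K (n :: s))) := by
      filter_upwards [hLO] with z hz ⟨h1, h2⟩
      exact h2 (hz.mpr h1)
    have hOne : ¬ IsMeagre O := fun h => hL <| by
      filter_upwards [hLO, h] with z hz h1 h2
      exact h1 (hz.mp h2)
    have hAL : IsMeagre (A s \ ⋃ n, K (n :: s)) := by
      rw [hA' s, iUnion_sdiff]
      exact isMeagre_iUnion fun n => (hAK (n :: s)).mono
        (sdiff_subset_sdiff_right (subset_iUnion (fun n => K (n :: s)) n))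
    have hAO : IsMeagre (A s ∩ O) := by
      refine (hAL.union hOL).mono fun z hz => ?_
      by_cases h : z ∈ ⋃ n, K (n :: s)
      · exact Or.inr ⟨hz.2, fun h' => h'.2 h⟩
      · exact Or.inl ⟨hz.1, h⟩
    exact hOne (IsMeagre.mono (s := O \ (K s \ ⋃ n, K (n :: s)))
      (fun z hz => ⟨hz, fun h => h.1 O hO hz hAO⟩) hOL)
  have hAnil : A [] = range f := by simp [hA, listCylinder_nil]
  have hKm : ¬ IsMeagre (K []) := fun h => hS' <| by
    refine (h.union (hAK [])).mono fun z hz => ?_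
    by_cases hzK : z ∈ K []
    · exact Or.inl hzK
    · exact Or.inr ⟨hAnil ▸ hz, hzK⟩
  refine ⟨interior (K []), isOpen_interior, ?_, ?_⟩
  · rw [nonempty_iff_ne_empty]
    exact fun h => hKm ((hKclosed []).isNowhereDense_iff.2 h).isMeagre
  · refine (isMeagre_iUnion hL).mono ?_
    rintro z ⟨hz, hzS⟩
    by_contra hzL
    simp only [mem_iUnion, Set.mem_sdiff, not_exists, not_and] at hzL
    obtain ⟨x, hx⟩ := exists_res_of_forall_exists_cons (P := fun s => z ∈ K s)
      (interior_subset hz) fun s hs => by simpa [hs] using hzL s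
    refine hzS ⟨x, eq_of_forall_mem_closure_image hf fun n => mem_closure_iff.2 fun O hO hzO => ?_⟩
    have := nonempty_of_not_isMeagre (hx n O hO hzO)
    simp only [hA, listCylinder_res] at this
    rwa [inter_comm]

/-- Nonempty open sets can be shrunk so that products of distinct ones lie in a given dense open
set. -/
theorem exists_box_subset {ι Z : Type*} [Fintype ι] [TopologicalSpace Z]
    {G : Set (Z × Z)} (hG : IsOpen G) (hGd : Dense G) (U : ι → Set Z)
    (hU : ∀ i, IsOpen (U i)) (hne : ∀ i, (U i).Nonempty) :
    ∃ V : ι → Set Z, (∀ i, IsOpen (V i) ∧ (V i).Nonempty ∧ V i ⊆ U i) ∧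
      ∀ i j, i ≠ j → V i ×ˢ V j ⊆ G := by
  classical
  have key : ∀ T : Finset (ι × ι), ∃ V : ι → Set Z,
      (∀ i, IsOpen (V i) ∧ (V i).Nonempty ∧ V i ⊆ U i) ∧
        ∀ p ∈ T, p.1 ≠ p.2 → V p.1 ×ˢ V p.2 ⊆ G := by
    intro T
    induction T using Finset.induction_on with
    | empty => exact ⟨U, fun i => ⟨hU i, hne i, subset_rfl⟩, by simp⟩
    | insert p T _ ih =>
      obtain ⟨V, hV, hVT⟩ := ih
      by_cases hp : p.1 = p.2
      · refine ⟨V, hV, fun q hq hq' => hVT q ?_ hq'⟩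
        rcases Finset.mem_insert.1 hq with rfl | h
        exacts [absurd hp hq', h]
      obtain ⟨⟨a, b⟩, ⟨ha, hb⟩, hab⟩ := hGd.inter_open_nonempty (V p.1 ×ˢ V p.2)
        ((hV _).1.prod (hV _).1) ((hV _).2.1.prod (hV _).2.1)
      obtain ⟨P, Q, hP, hQ, haP, hbQ, hPQ⟩ := isOpen_prod_iff.1 hG a b hab
      let W : ι → Set Z := fun i => if i = p.1 then V i ∩ P else if i = p.2 then V i ∩ Q else V i
      have hWV i : W i ⊆ V i := by
        simp only [W]; split_ifs <;> simp
      refine ⟨W, fun i => ⟨?_, ?_, (hWV i).trans (hV i).2.2⟩, fun q hq hq' => ?_⟩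
      · simp only [W]; split_ifs
        exacts [(hV i).1.inter hP, (hV i).1.inter hQ, (hV i).1]
      · simp only [W]; split_ifs with h1 h2
        · subst h1; exact ⟨a, ha, haP⟩
        · subst h2; exact ⟨b, hb, hbQ⟩
        · exact (hV i).2.1
      · rcases Finset.mem_insert.1 hq with rfl | h
        · refine Subset.trans (prod_mono ?_ ?_) hPQ
          · simp [W]
          · simp [W, Ne.symm hp]
        · exact (prod_mono (hWV _) (hWV _)).trans (hVT q h hq')
  obtain ⟨V, hV, h⟩ := key Finset.univ
  exact ⟨V, hV, fun i j hij => h (i, j) (Finset.mem_univ _) hij⟩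

theorem exists_small_open_subset {Z : Type*} [MetricSpace Z] {U : Set Z}
    (hU : IsOpen U) (hne : U.Nonempty) {ε : ENNReal} (hε : 0 < ε) :
    ∃ V : Set Z, IsOpen V ∧ V.Nonempty ∧ closure V ⊆ U ∧ Metric.ediam V ≤ ε := by
  obtain ⟨z, hz⟩ := hne
  obtain ⟨r, hr, hrU⟩ := EMetric.isOpen_iff.1 hU z hz
  have hδ : 0 < min (r / 2) (ε / 2) := lt_min (ENNReal.half_pos hr.ne') (ENNReal.half_pos hε.ne')
  refine ⟨Metric.eball z (min (r / 2) (ε / 2)), Metric.isOpen_eball,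
    ⟨z, Metric.mem_eball_self hδ⟩, ?_, ?_⟩
  · refine Subset.trans (closure_mono (Metric.eball_subset_closedEBall.trans
      (Metric.closedEBall_subset_closedEBall (min_le_left _ _)))) ?_
    rw [Metric.isClosed_closedEBall.closure_eq]
    by_cases hr' : r = ⊤
    · subst hr'
      have : U = Set.univ := by simpa using hrU
      exact this ▸ subset_univ _
    exact fun y hy => hrU (lt_of_le_of_lt hy (ENNReal.half_lt_self hr.ne' hr'))
  · refine Metric.ediam_eball_le.trans ?_
    calc 2 * min (r / 2) (ε / 2) ≤ 2 * (ε / 2) := by gcongr; exact min_le_right _ _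
      _ = ε := ENNReal.mul_div_cancel two_ne_zero ENNReal.ofNat_ne_top

/-- **Mycielski's theorem** for binary relations: given a meagre subset `M` of the square of a
nonempty Polish space, there is a copy of the Cantor space whose distinct
points are never related by `M`. -/
theorem exists_continuous_cantor_forall_notMem {Z : Type*} [TopologicalSpace Z] [PolishSpace Z]
    [Nonempty Z] {M : Set (Z × Z)} (hM : IsMeagre M) :
    ∃ f : (ℕ → Bool) → Z, Continuous f ∧ ∀ a b, a ≠ b → (f a, f b) ∉ M := by
  let := TopologicalSpace.upgradeIsCompletelyMetrizable Z
  obtain ⟨G, hGo, hGd, hGanti, hGM⟩ : ∃ G : ℕ → Set (Z × Z), (∀ n, IsOpen (G n)) ∧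
      (∀ n, Dense (G n)) ∧ Antitone G ∧ Disjoint (⋂ n, G n) M := by
    obtain ⟨S, hSo, hSd, hSc, hSM⟩ := mem_residual_iff.1 hM
    obtain ⟨g, hg⟩ := (hSc.insert Set.univ).exists_eq_range (insert_nonempty _ _)
    have hgo n : IsOpen (g n) ∧ Dense (g n) := by
      rcases hg ▸ mem_range_self n with h | h
      · exact h ▸ ⟨isOpen_univ, dense_univ⟩
      · exact ⟨hSo _ h, hSd _ h⟩
    have hfin n : IsOpen (⋂ i ∈ Finset.range n, g i) := isOpen_biInter_finset fun i _ => (hgo i).1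
    refine ⟨fun n => ⋂ i ∈ Finset.range n, g i, hfin, fun n => ?_, fun m n hmn => ?_, ?_⟩
    · induction n with
      | zero => simp
      | succ n ih =>
        simp only [Finset.range_add_one, Finset.set_biInter_insert] at ih ⊢
        exact (hgo n).2.inter_of_isOpen_left ih (hgo n).1
    · exact biInter_subset_biInter_left (Finset.range_mono hmn)
    · refine disjoint_left.2 fun p hp hpM => hSM (mem_sInter.2 fun t ht => ?_) hpM
      obtain ⟨n, rfl⟩ : t ∈ range g := hg ▸ mem_insert_of_mem _ ht
      exact mem_iInter₂.1 (mem_iInter.1 hp (n + 1)) n (by simp)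
  let State := {U : List Bool → Set Z // ∀ l, IsOpen (U l) ∧ (U l).Nonempty}
  have step (n : ℕ) (U : State) : ∃ V : State,
      (∀ l : List Bool, ∀ b, closure (V.1 (b :: l)) ⊆ U.1 l) ∧
      (∀ l, Metric.ediam (V.1 l) ≤ ((n : ENNReal) + 1)⁻¹) ∧
      ∀ l l' : List Bool, l.length = n + 1 → l'.length = n + 1 → l ≠ l' →
        V.1 l ×ˢ V.1 l' ⊆ G n := by
    have hε : (0 : ENNReal) < ((n : ENNReal) + 1)⁻¹ := by simp
    choose W hWo hWne hWU hWd using fun l : List Bool =>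
      exists_small_open_subset (U.2 l.tail).1 (U.2 l.tail).2 hε
    obtain ⟨V, hV, hVG⟩ := exists_box_subset (ι := List.Vector Bool (n + 1)) (hGo n) (hGd n)
      (fun v => W v.1) (fun v => hWo _) fun v => hWne _
    let V' : List Bool → Set Z := fun l => if h : l.length = n + 1 then V ⟨l, h⟩ else W l
    have hV'W l : V' l ⊆ W l := by
      simp only [V']; split_ifs
      exacts [(hV _).2.2, subset_rfl]
    refine ⟨⟨V', fun l => ?_⟩, fun l b => (closure_mono (hV'W _)).trans (hWU (b :: l)),
      fun l => (Metric.ediam_mono (hV'W _)).trans (hWd l), fun l l' hl hl' hne => ?_⟩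
    · simp only [V']; split_ifs
      exacts [⟨(hV _).1, (hV _).2.1⟩, ⟨hWo _, hWne _⟩]
    · simp only [V', hl, hl', dif_pos]
      exact hVG _ _ fun h => hne (congrArg Subtype.val h)
  choose next hnext hdiam hG using step
  let u : ℕ → State := fun n =>
    Nat.rec ⟨fun _ => Set.univ, fun _ => ⟨isOpen_univ, univ_nonempty⟩⟩ next n
  let A : List Bool → Set Z := fun l => (u l.length).1 l
  have hAanti : CantorScheme.ClosureAntitone A := fun l b => hnext l.length (u l.length) l b
  have hAdiam : CantorScheme.VanishingDiam A := by
    intro x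
    rw [← tendsto_add_atTop_iff_nat 1]
    refine tendsto_of_tendsto_of_tendsto_of_le_of_le tendsto_const_nhds ?_
      (fun _ => zero_le) (fun n => ?_) (g := fun _ => 0) (h := fun n : ℕ => ((n : ENNReal) + 1)⁻¹)
    · have := (tendsto_add_atTop_iff_nat 1).2 ENNReal.tendsto_inv_nat_nhds_zero
      simpa using this
    · have := hdiam n (u n) (res x (n + 1))
      simpa only [A, res_length] using this
  have hdom := hAanti.map_of_vanishingDiam hAdiam fun l => ((u l.length).2 l).2
  let f : (ℕ → Bool) → Z := fun x => (CantorScheme.inducedMap A).2 ⟨x, hdom ▸ mem_univ x⟩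
  refine ⟨f, hAdiam.map_continuous.comp (by fun_prop), fun a b hab hMab => ?_⟩
  have hmem (x : ℕ → Bool) (n : ℕ) : f x ∈ A (res x n) := CantorScheme.map_mem _ n
  obtain ⟨m, hm⟩ := Function.ne_iff.1 hab
  refine hGM.le_bot ⟨mem_iInter.2 fun n => hGanti (le_max_left n m) ?_, hMab⟩
  set k := max n m
  refine hG k (u k) (res a (k + 1)) (res b (k + 1)) (res_length _ _) (res_length _ _)
    (fun h => hm (res_eq_res.1 h (Nat.lt_succ_of_le (le_max_right n m)))) ⟨?_, ?_⟩
  · simpa only [A, res_length] using hmem a (k + 1)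
  · simpa only [A, res_length] using hmem b (k + 1)

/-- If an analytic equivalence relation on a Polish space is such that every nonempty open set
contains a nonempty open set moved inside it, inequivalently, by some homeomorphism, then it has a
Cantor set of pairwise inequivalent points. -/
theorem exists_continuous_cantor_of_forall_isOpen {Z : Type*} [TopologicalSpace Z] [PolishSpace Z]
    [Nonempty Z] {E : Z → Z → Prop} (hE : Equivalence E)
    (hEa : MeasureTheory.AnalyticSet {p : Z × Z | E p.1 p.2})
    (h : ∀ A : Set Z, IsOpen A → A.Nonempty → ∃ σ : Z ≃ₜ Z, ∃ D ⊆ A,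
      IsOpen D ∧ D.Nonempty ∧ MapsTo σ D A ∧ ∀ x ∈ D, ¬ E x (σ x)) :
    ∃ f : (ℕ → Bool) → Z, Continuous f ∧ ∀ a b, a ≠ b → ¬ E (f a) (f b) := by
  refine exists_continuous_cantor_forall_notMem (M := {p : Z × Z | E p.1 p.2}) ?_
  by_contra hM
  obtain ⟨O, hO, ⟨⟨x, y⟩, hxy⟩, hOE⟩ := hEa.exists_isOpen_isMeagre_diff hM
  obtain ⟨A, B, hA, hB, hxA, hyB, hAB⟩ := isOpen_prod_iff.1 hO x y hxy
  obtain ⟨σ, D, hDA, hD, ⟨d, hd⟩, hσ, hDE⟩ := h A hA ⟨x, hxA⟩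
  let σ' : Z × Z ≃ₜ Z × Z := σ.prodCongr (Homeomorph.refl Z)
  refine not_isMeagre_of_isOpen (hD.prod hB) ⟨(d, y), hd, hyB⟩ ?_
  refine IsMeagre.mono ?_ (hOE.union (hOE.preimage_of_isOpenMap σ'.continuous σ'.isOpenMap))
  rintro ⟨a, b⟩ ⟨ha, hb⟩
  by_cases hab : E a b
  · exact Or.inr ⟨hAB ⟨hσ ha, hb⟩, fun h' => hDE a ha (hE.trans hab (hE.symm h'))⟩
  · exact Or.inl ⟨hAB ⟨hDA ha, hb⟩, hab⟩

/-- A version of `exists_continuous_cantor_of_forall_isOpen` relative to a notion of largeness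
given by a σ-complete filter `F`. -/
theorem exists_continuous_cantor_of_forall_frequently {X : Type*} [TopologicalSpace X]
    [PolishSpace X] (F : Filter X) [CountableInterFilter F] [NeBot F] {E : X → X → Prop}
    (hE : Equivalence E) (hEa : MeasureTheory.AnalyticSet {p : X × X | E p.1 p.2})
    {𝓑 : Set (Set X)} (h𝓑 : TopologicalSpace.IsTopologicalBasis 𝓑)
    (h : ∀ A ∈ 𝓑, (∃ᶠ x in F, x ∈ A) → ∃ σ : X ≃ₜ X, Tendsto σ F F ∧ Tendsto σ.symm F F ∧
      ∃ D ⊆ A, IsOpen D ∧ (∃ᶠ x in F, x ∈ D) ∧ MapsTo σ D A ∧ ∀ x ∈ D, ¬ E x (σ x)) :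
    ∃ f : (ℕ → Bool) → X, Continuous f ∧ ∀ a b, a ≠ b → ¬ E (f a) (f b) := by
  let X' : Set X := {x | ClusterPt x F}
  have hX' : IsClosed X' := isClosed_setOfPred_clusterPt
  have key (U : Set X) (hU : ∃ᶠ x in F, x ∈ U) : ∃ x ∈ U, x ∈ X' := by
    have : NeBot (F ⊓ 𝓟 U) := frequently_mem_iff_neBot.1 hU
    obtain ⟨x, hxU, hx⟩ := HereditarilyLindelofSpace.isLindelof U (f := F ⊓ 𝓟 U) inf_le_right
    exact ⟨x, hxU, hx.mono inf_le_left⟩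
  have : PolishSpace X' := hX'.polishSpace
  have : Nonempty X' := by
    obtain ⟨x, -, hx⟩ := key Set.univ (Frequently.of_forall fun _ => mem_univ _)
    exact ⟨⟨x, hx⟩⟩
  have hE' : Equivalence fun x y : X' => E x y :=
    ⟨fun x => hE.refl x, fun h => hE.symm h, fun h h' => hE.trans h h'⟩
  obtain ⟨f, hf, hfE⟩ := exists_continuous_cantor_of_forall_isOpen hE'
    (hEa.preimage (f := fun p : X' × X' => ((p.1 : X), (p.2 : X))) (by fun_prop)) fun A hA hne => by
      obtain ⟨U, hU, rfl⟩ := isOpen_induced_iff.1 hA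
      obtain ⟨x, hxU⟩ := hne
      obtain ⟨V, hV, hxV, hVU⟩ := h𝓑.exists_subset_of_mem_open hxU hU
      obtain ⟨σ, hσ, hσ', D, hDV, hD, hDF, hDσ, hDE⟩ := h V hV
        (clusterPt_iff_frequently.1 x.2 V ((h𝓑.isOpen hV).mem_nhds hxV))
      refine ⟨σ.subtype fun y => ⟨fun hy => hy.map σ.continuous.continuousAt hσ, fun hy => ?_⟩,
        ((↑) : X' → X) ⁻¹' D, fun y hy => hVU (hDV hy), hD.preimage continuous_subtype_val, ?_,
        fun y hy => hVU (hDσ hy), fun y hy => hDE y hy⟩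
      · have : ClusterPt (σ.symm (σ y)) F := hy.map σ.symm.continuous.continuousAt hσ'
        rwa [σ.symm_apply_apply] at this
      · obtain ⟨y, hyD, hy⟩ := key D hDF
        exact ⟨⟨y, hy⟩, hyD⟩
  exact ⟨fun a => f a, by fun_prop, hfE⟩

/-- A countable family of closed sets of a Polish space generates a Polish topology, provided that
this topology is finer than the original one. -/
theorem polishSpace_generateFrom {X : Type*} [t : TopologicalSpace X] [hX : PolishSpace X]
    {𝓑 : Set (Set X)} (hc : 𝓑.Countable) (hcl : ∀ A ∈ 𝓑, IsClosed A)
    (hle : generateFrom 𝓑 ≤ t) : @PolishSpace X (generateFrom 𝓑) := by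
  classical
  let f (A : Set X) : A ⊕ (Aᶜ : Set X) ≃ X := Equiv.Set.sumCompl A
  let T (A : Set X) : TopologicalSpace X := .coinduced (f A) instTopologicalSpaceSum
  have hT (A : Set X) : T A ≤ t := by
    simp only [T, instTopologicalSpaceSum, coinduced_sup, coinduced_compose, sup_le_iff,
      ← continuous_iff_coinduced_le]
    exact ⟨continuous_subtype_val, continuous_subtype_val⟩
  have hTP (A : Set X) (hA : IsClosed A) : @PolishSpace X (T A) := by
    have := hA.polishSpace
    have := hA.isOpen_compl.polishSpace
    rw [show T A = _ from congrFun (f A).induced_symm.symm _]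
    exact (f A).symm.polishSpace_induced
  have hTA (A : Set X) : IsOpen[T A] A := by
    rw [isOpen_coinduced, isOpen_sum_iff]
    simp [preimage_preimage, f]
  have hgen : generateFrom 𝓑 = ⨅ o : Option 𝓑, o.elim t fun A => T A := by
    apply le_antisymm
    · refine le_iInf fun o => ?_
      rcases o with _ | ⟨A, hA⟩
      · exact hle
      change generateFrom 𝓑 ≤ T A
      intro O hO
      rw [isOpen_coinduced, isOpen_sum_iff] at hO
      obtain ⟨⟨U, hU, hUO⟩, ⟨V, hV, hVO⟩⟩ := hO
      have hO' : O = A ∩ U ∪ Aᶜ ∩ V := by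
        ext x
        by_cases hx : x ∈ A
        · simpa [hx, f] using (Set.ext_iff.1 hUO ⟨x, hx⟩).symm
        · simpa [hx, f] using (Set.ext_iff.1 hVO ⟨x, hx⟩).symm
      rw [hO']
      exact @IsOpen.union _ _ _ (generateFrom 𝓑) 
        (TopologicalSpace.GenerateOpen.inter A U (.basic _ hA) (hle _ hU))
        (hle _ ((hcl A hA).isOpen_compl.inter hV))
    · exact le_generateFrom fun A hA => iInf_le (fun o : Option 𝓑 => o.elim t fun A => T A)
        (some ⟨A, hA⟩) _ (hTA A)
  rw [hgen]
  have := hc.to_subtype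
  refine PolishSpace.iInf ⟨none, ?_⟩ ?_
  · rintro (_ | A)
    exacts [le_rfl, hT A]
  · rintro (_ | A)
    exacts [hX, hTP A (hcl A A.2)]

/-- Transfinite approximations, from below, to the complement of `f '' listCylinder s`. -/
def complApprox {Z : Type*} [TopologicalSpace Z] (f : (ℕ → ℕ) → Z) (α : Ordinal.{0})
    (s : List ℕ) : Set Z :=
  (closure (f '' listCylinder s))ᶜ ∪ ⋂ n, ⋃ β : Iio α, complApprox f β (n :: s)
termination_by α
decreasing_by exact β.2

theorem measurableSet_complApprox {Z : Type*} [TopologicalSpace Z] [MeasurableSpace Z]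
    [BorelSpace Z] (f : (ℕ → ℕ) → Z) {α : Ordinal.{0}} (hα : α < Ordinal.omega 1) (s : List ℕ) :
    MeasurableSet (complApprox f α s) := by
  induction α using WellFoundedLT.induction generalizing s with
  | ind α ih =>
    have : Countable (Iio α) := by
      rw [← mk_le_aleph0_iff, mk_Iio_ordinal, lift_le_aleph0, ← Order.lt_succ_iff, succ_aleph0]
      exact lt_omega_iff_card_lt.1 hα
    rw [complApprox]
    exact isClosed_closure.measurableSet.compl.union
      (.iInter fun n => .iUnion fun β => ih β β.2 (β.2.trans hα) _)

theorem disjoint_complApprox {Z : Type*} [TopologicalSpace Z] (f : (ℕ → ℕ) → Z) (α : Ordinal.{0})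
    (s : List ℕ) : Disjoint (complApprox f α s) (f '' listCylinder s) := by
  induction α using WellFoundedLT.induction generalizing s with
  | ind α ih =>
    rw [complApprox, disjoint_union_left]
    refine ⟨(disjoint_compl_left_iff_subset.2 subset_closure), disjoint_left.2 fun z hz hzs => ?_⟩
    rw [listCylinder_eq_iUnion, image_iUnion] at hzs
    obtain ⟨n, hn⟩ := mem_iUnion.1 hzs
    obtain ⟨β, hβ⟩ := mem_iUnion.1 (mem_iInter.1 hz n)
    exact (ih β β.2 _).le_bot ⟨hβ, hn⟩

theorem exists_mem_complApprox {Z : Type*} [TopologicalSpace Z] [T2Space Z] {f : (ℕ → ℕ) → Z}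
    (hf : Continuous f) {z : Z} (hz : z ∉ range f) :
    ∃ α < Ordinal.omega 1, z ∈ complApprox f α [] := by
  by_contra! h
  obtain ⟨x, hx⟩ := exists_res_of_forall_exists_cons
    (P := fun s => ∀ α < Ordinal.omega 1, z ∉ complApprox f α s) h fun s hs => by
      by_contra! hn
      choose g hg hgz using hn
      have hsup : ⨆ n, Order.succ (g n) < Ordinal.omega 1 :=
        Ordinal.iSup_lt_omega_one fun n => (isSuccLimit_omega 1).succ_lt (hg n)
      refine hs _ hsup ?_
      rw [complApprox]
      refine Or.inr (mem_iInter.2 fun n => mem_iUnion.2 ⟨⟨g n, ?_⟩, hgz n⟩)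
      exact (Order.lt_succ _).trans_le (Ordinal.le_iSup (fun n => Order.succ (g n)) n)
  refine hz ⟨x, eq_of_forall_mem_closure_image hf fun n => ?_⟩
  by_contra hzn
  refine hx n 0 (Ordinal.omega_pos 1) ?_
  rw [complApprox, listCylinder_res]
  exact Or.inl hzn

/-- The complement of an analytic set is a union of at most `ℵ₁` analytic sets. -/
theorem exists_iUnion_range_eq_compl_range {Z : Type*} [TopologicalSpace Z] [PolishSpace Z]
    {f : (ℕ → ℕ) → Z} (hf : Continuous f) :
    ∃ (ι : Type) (h : ι → (ℕ → ℕ) → Z), #ι ≤ aleph 1 ∧ (∀ i, Continuous (h i)) ∧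
      ⋃ i, range (h i) = (range f)ᶜ := by
  borelize Z
  let B (i : (Ordinal.omega 1).ToType) : Set Z := complApprox f (Ordinal.ToType.mk.symm i).1 []
  have hB (i : {i // (B i).Nonempty}) : ∃ h : (ℕ → ℕ) → Z, Continuous h ∧ range h = B i := by
    have := (measurableSet_complApprox f (mem_Iio.1 (Ordinal.ToType.mk.symm i.1).2) []).analyticSet
    rw [MeasureTheory.AnalyticSet] at this
    exact this.resolve_left i.2.ne_empty
  choose h hh hhB using hB
  refine ⟨{i // (B i).Nonempty}, h, (mk_subtype_le _).trans ?_, hh, ?_⟩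
  · simp
  ext z
  simp only [hhB, mem_iUnion, mem_compl_iff]
  constructor
  · rintro ⟨i, hi⟩ hz
    exact (disjoint_complApprox f _ []).le_bot ⟨hi, by simpa [listCylinder_nil] using hz⟩
  · intro hz
    obtain ⟨α, hα, hzα⟩ := exists_mem_complApprox hf hz
    have : z ∈ B (Ordinal.ToType.mk ⟨α, hα⟩) := by simpa [B] using hzα
    exact ⟨⟨_, z, this⟩, this⟩

/-- A combination of `exists_continuous_cantor_of_forall_frequently` and
`polishSpace_generateFrom`: it suffices to split large sets from a countable family `𝓑` of closed
sets which is closed under finite intersections and invariant under the involutions `σ k`. -/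
theorem exists_continuous_cantor_of_countable_family {X R : Type*} [t : TopologicalSpace X]
    [PolishSpace X] [TopologicalSpace R] [PolishSpace R] {E : R → R → Prop} (hE : Equivalence E)
    (hEa : MeasureTheory.AnalyticSet {p : R × R | E p.1 p.2}) {π : X → R} (hπ : Continuous π)
    (F : Filter X) [CountableInterFilter F] [NeBot F] {𝓑 : Set (Set X)} (hc : 𝓑.Countable)
    (hcl : ∀ A ∈ 𝓑, IsClosed A) (huniv : Set.univ ∈ 𝓑) (hinter : ∀ A ∈ 𝓑, ∀ B ∈ 𝓑, A ∩ B ∈ 𝓑)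
    (hle : generateFrom 𝓑 ≤ t) {σ : ℕ → X → X} (hσ : ∀ k, Function.Involutive (σ k))
    (hσ𝓑 : ∀ k, ∀ A ∈ 𝓑, σ k ⁻¹' A ∈ 𝓑) (hσF : ∀ k, Tendsto (σ k) F F)
    (h : ∀ A ∈ 𝓑, (∃ᶠ x in F, x ∈ A) → ∃ k, ∃ D ∈ 𝓑, D ⊆ A ∧ (∃ᶠ x in F, x ∈ D) ∧
      MapsTo (σ k) D A ∧ ∀ x ∈ D, ¬ E (π x) (π (σ k x))) :
    ∃ f : (ℕ → Bool) → R, Continuous f ∧ ∀ a b, a ≠ b → ¬ E (f a) (f b) := by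
  have hP := polishSpace_generateFrom hc hcl hle
  replace hπ := continuous_le_dom hle hπ
  clear hcl hle
  let := generateFrom 𝓑
  have hbasis : TopologicalSpace.IsTopologicalBasis 𝓑 := by
    have := TopologicalSpace.isTopologicalBasis_of_subbasis_of_inter rfl fun A hA B hB =>
      hinter A hA B hB
    rwa [insert_eq_of_mem huniv] at this
  have hσc (k : ℕ) : Continuous (σ k) := continuous_generateFrom_iff.2 fun A hA =>
    TopologicalSpace.isOpen_generateFrom_of_mem (hσ𝓑 k A hA)
  let σ' (k : ℕ) : X ≃ₜ X := ⟨(hσ k).toPerm, hσc k, hσc k⟩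
  have hE' : Equivalence fun x y => E (π x) (π y) :=
    ⟨fun x => hE.refl _, fun h => hE.symm h, fun h h' => hE.trans h h'⟩
  obtain ⟨f, hf, hfE⟩ := exists_continuous_cantor_of_forall_frequently F hE'
    (hEa.preimage (f := fun p : X × X => (π p.1, π p.2)) (by fun_prop)) hbasis fun A hA hAF => by
      obtain ⟨k, D, hD, hDA, hDF, hDσ, hDE⟩ := h A hA hAF
      exact ⟨σ' k, hσF k, hσF k, D, hDA, hbasis.isOpen hD, hDF, hDσ, hDE⟩
  exact ⟨π ∘ f, hπ.comp hf, hfE⟩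

/-- A countable set is contained in a countable set closed under countably many binary
operations. -/
theorem exists_countable_superset_closed {α J : Type*} [Countable J] (op : J → α → α → α)
    {S : Set α} (hS : S.Countable) : ∃ T : Set α, S ⊆ T ∧ T.Countable ∧
      (∀ j, ∀ a ∈ T, ∀ b ∈ T, op j a b ∈ T) ∧
      ∀ P : α → Prop, (∀ a ∈ S, P a) → (∀ j a b, P a → P b → P (op j a b)) → ∀ a ∈ T, P a := by
  let u (n : ℕ) : Set α := Nat.rec S (fun _ A => A ∪ ⋃ j, image2 (op j) A A) n
  have hu (n : ℕ) : u (n + 1) = u n ∪ ⋃ j, image2 (op j) (u n) (u n) := rfl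
  have hmono : Monotone u := monotone_nat_of_le_succ fun n => hu n ▸ subset_union_left
  refine ⟨⋃ n, u n, subset_iUnion u 0, countable_iUnion fun n => ?_, fun j a ha b hb => ?_,
    fun P hP hop a ha => ?_⟩
  · induction n with
    | zero => exact hS
    | succ n ih => exact hu n ▸ ih.union (countable_iUnion fun j => ih.image2 ih _)
  · obtain ⟨m, hm⟩ := mem_iUnion.1 ha
    obtain ⟨n, hn⟩ := mem_iUnion.1 hb
    refine mem_iUnion.2 ⟨max m n + 1, hu _ ▸ Or.inr (mem_iUnion.2 ⟨j, mem_image2_of_mem ?_ ?_⟩)⟩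
    exacts [hmono (le_max_left m n) hm, hmono (le_max_right m n) hn]
  · obtain ⟨n, hn⟩ := mem_iUnion.1 ha
    induction n generalizing a with
    | zero => exact hP a hn
    | succ n ih =>
      rcases hu n ▸ hn with h | h
      · exact ih a (mem_iUnion.2 ⟨n, h⟩) h
      · obtain ⟨j, b, hb, c, hc, rfl⟩ := mem_iUnion.1 h
        exact hop j b c (ih b (mem_iUnion.2 ⟨n, hb⟩) hb) (ih c (mem_iUnion.2 ⟨n, hc⟩) hc)

/-- The involution of `ℕ` exchanging the blocks `[0, k)` and `[k, 2k)`. -/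
def swapBlocks (k i : ℕ) : ℕ := if i < k then i + k else if i < 2 * k then i - k else i

theorem swapBlocks_involutive (k : ℕ) : Function.Involutive (swapBlocks k) := by
  intro i
  grind [swapBlocks]

theorem swapBlocks_lt {k m i : ℕ} (hi : i < m) : swapBlocks k i < m + 2 * k := by
  grind [swapBlocks]

theorem DependsOn.comp_swapBlocks {α β : Type*} {k m : ℕ} {A : (ℕ → α) → β}
    (hA : DependsOn A (Iio m)) : DependsOn (fun x => A (x ∘ swapBlocks k)) (Iio (m + 2 * k)) :=
  fun _ _ hxy => hA fun _ hi => hxy _ (swapBlocks_lt hi)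

section

variable {R : Type*}

/-- Sequences of pairs whose first components all belong to `V`. -/
def fstBox (V : Set R) : Set (ℕ → R × (ℕ → ℕ)) := {x | ∀ i, (x i).1 ∈ V}

theorem monotone_fstBox : Monotone (fstBox (R := R)) := fun _ _ h _ hx i => h (hx i)

/-- The filter of sets of sequences whose first components are generic for `G`. -/
def fstFilter (G : Filter R) : Filter (ℕ → R × (ℕ → ℕ)) := G.lift' fstBox

theorem mem_fstFilter {G : Filter R} {W : Set (ℕ → R × (ℕ → ℕ))} :
    W ∈ fstFilter G ↔ ∃ V ∈ G, fstBox V ⊆ W :=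
  mem_lift'_sets monotone_fstBox

instance (G : Filter R) [NeBot G] : NeBot (fstFilter G) :=
  (lift'_neBot_iff monotone_fstBox).2 fun V hV => by
    obtain ⟨r, hr⟩ := Filter.nonempty_of_mem hV
    exact ⟨fun _ => (r, fun _ => 0), fun _ => hr⟩

instance (G : Filter R) [CountableInterFilter G] : CountableInterFilter (fstFilter G) where
  countable_sInter_mem S hS h := by
    choose! V hV hVS using fun W hW => mem_fstFilter.1 (h W hW)
    refine mem_fstFilter.2 ⟨⋂ W ∈ S, V W, (countable_bInter_mem hS).2 hV, fun x hx W hW => ?_⟩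
    exact hVS W hW (monotone_fstBox (biInter_subset_of_mem hW) hx)

theorem tendsto_comp_fstFilter (G : Filter R) (s : ℕ → ℕ) :
    Tendsto (fun x => x ∘ s) (fstFilter G) (fstFilter G) := fun W hW => by
  obtain ⟨V, hV, hVW⟩ := mem_fstFilter.1 hW
  exact mem_fstFilter.2 ⟨V, hV, fun x hx => hVW fun i => hx (s i)⟩

/-- The points of `A` that remain in `A` when the blocks `[0, k)` and `[k, 2k)` are exchanged,
and for which the pair formed by the first coordinates of these blocks is the image under `h` of
the point recorded at position `2k`. -/
def splitSet (k : ℕ) (h : (ℕ → ℕ) → R × R) (A : Set (ℕ → R × (ℕ → ℕ))) :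
    Set (ℕ → R × (ℕ → ℕ)) :=
  {x | (x ∈ A ∧ x ∘ swapBlocks k ∈ A) ∧ h (x (2 * k)).2 = ((x 0).1, (x k).1)}

theorem dependsOn_splitSet {k m : ℕ} {h : (ℕ → ℕ) → R × R} {A : Set (ℕ → R × (ℕ → ℕ))}
    (hA : DependsOn (· ∈ A) (Iio m)) :
    DependsOn (· ∈ splitSet k h A) (Iio (m + 2 * k + 1)) := by
  intro x y hxy
  have h1 := hA fun i hi => hxy i (by simp at hi ⊢; omega)
  have h2 := hA.comp_swapBlocks (k := k) fun i hi => hxy i (by simp at hi ⊢; omega)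
  have h3 := hxy 0 (by simp)
  have h4 := hxy k (by simp; omega)
  have h5 := hxy (2 * k) (by simp)
  simp only at h1 h2
  simp only [splitSet, mem_ofPred_eq, h1, h2, h3, h4, h5]

theorem isClosed_splitSet [TopologicalSpace R] [T2Space R] {k : ℕ} {h : (ℕ → ℕ) → R × R}
    (hh : Continuous h) {A : Set (ℕ → R × (ℕ → ℕ))} (hA : IsClosed A) :
    IsClosed (splitSet k h A) :=
  (hA.inter (hA.preimage (continuous_pi fun _ => continuous_apply _))).inter
    (isClosed_eq (by fun_prop) (by fun_prop))

/-- Large sets with finite support can be split by one of the functions `h i` enumerating the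
pairs of inequivalent points. -/
theorem exists_frequently_splitSet {E : R → R → Prop} {G : Filter R}
    (hGE : ∀ r, {r' | ¬ E r r'} ∈ G) {ι : Type*} (hGι : ∀ V : ι → Set R, (∀ i, V i ∈ G) →
      ⋂ i, V i ∈ G) {h : ι → (ℕ → ℕ) → R × R} (hh : ⋃ i, range (h i) = {p : R × R | E p.1 p.2}ᶜ)
    {A : Set (ℕ → R × (ℕ → ℕ))} {k : ℕ} (hk : 0 < k) (hA : DependsOn (· ∈ A) (Iio k))
    (hAG : ∃ᶠ x in fstFilter G, x ∈ A) :
    ∃ i, ∃ᶠ x in fstFilter G, x ∈ splitSet k (h i) A := by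
  by_contra! hcon
  choose V hV hVA using fun i => mem_fstFilter.1 (hcon i)
  have hVG := hGι V hV
  obtain ⟨a, haA, ha⟩ := (hAG.and_eventually (mem_fstFilter.2 ⟨_, hVG, subset_rfl⟩)).exists
  have key (b) (hbA : b ∈ A) (hb : b ∈ fstBox (⋂ i, V i)) : E (a 0).1 (b 0).1 := by
    by_contra hab
    have : ((a 0).1, (b 0).1) ∈ ⋃ i, range (h i) := hh ▸ hab
    obtain ⟨i, w, hw⟩ := mem_iUnion.1 this
    let d (j : ℕ) : R × (ℕ → ℕ) :=
      if j < k then a j else if j < 2 * k then b (j - k) else ((a 0).1, w)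
    have hd : d ∈ fstBox (⋂ i, V i) := fun j => by
      simp only [d]
      split_ifs
      exacts [ha _, hb _, ha 0]
    refine hVA i (monotone_fstBox (iInter_subset V i) hd) ⟨⟨?_, ?_⟩, ?_⟩
    · refine (hA fun j hj => ?_).mpr haA
      simp [d, mem_Iio.1 hj]
    · refine (hA fun j hj => ?_).mpr hbA
      have : j < k := hj
      have : j + k < 2 * k := by omega
      simp [d, swapBlocks, *]
    · have : k < 2 * k := by omega
      simp [d, hk, this, hw]
  obtain ⟨b, hbA, hb⟩ := (hAG.and_eventually
    (mem_fstFilter.2 ⟨_, inter_mem hVG (hGE (a 0).1), subset_rfl⟩)).exists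
  exact (hb 0).2 (key b hbA (monotone_fstBox inter_subset_left hb))

end

/-- If a family of sets contains the preimages under all coordinate projections of the closures of
basic open sets, then it generates a topology finer than the product topology. -/
theorem generateFrom_le_pi {Y : Type*} [TopologicalSpace Y] [RegularSpace Y]
    [SecondCountableTopology Y] {𝓑 : Set (Set (ℕ → Y))}
    (h : ∀ i, ∀ V ∈ TopologicalSpace.countableBasis Y, {x | x i ∈ closure V} ∈ 𝓑) :
    generateFrom 𝓑 ≤ Pi.topologicalSpace := by
  refine le_iInf fun i => continuous_iff_le_induced.1 ?_
  let := generateFrom 𝓑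
  refine continuous_def.2 fun U hU => ?_
  have : (fun x : ℕ → Y => x i) ⁻¹' U =
      ⋃ V ∈ {V ∈ TopologicalSpace.countableBasis Y | closure V ⊆ U}, {x | x i ∈ closure V} := by
    ext x
    simp only [mem_preimage, mem_iUnion, exists_prop]
    constructor
    · intro hx
      obtain ⟨V, hV, hxV, hVU⟩ := (TopologicalSpace.isBasis_countableBasis Y).exists_closure_subset
        (hU.mem_nhds hx)
      exact ⟨V, ⟨hV, hVU⟩, subset_closure hxV⟩
    · rintro ⟨V, ⟨-, hVU⟩, hx⟩
      exact hVU hx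
  rw [this]
  exact isOpen_biUnion fun V hV => TopologicalSpace.isOpen_generateFrom_of_mem (h i V hV.1)

/-- An analytic equivalence relation has a Cantor set of pairwise inequivalent points as soon as
there is a σ-complete filter that avoids every class and allows for an enumeration of the
inequivalent pairs. -/
theorem exists_continuous_cantor_of_filter {R : Type*} [TopologicalSpace R] [PolishSpace R]
    {E : R → R → Prop} (hE : Equivalence E)
    (hEa : MeasureTheory.AnalyticSet {p : R × R | E p.1 p.2}) {G : Filter R}
    [CountableInterFilter G] [NeBot G] (hGE : ∀ r, {r' | ¬ E r r'} ∈ G) {ι : Type*}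
    (hGι : ∀ V : ι → Set R, (∀ i, V i ∈ G) → ⋂ i, V i ∈ G) {h : ι → (ℕ → ℕ) → R × R}
    (hhc : ∀ i, Continuous (h i)) (hh : ⋃ i, range (h i) = {p : R × R | E p.1 p.2}ᶜ) :
    ∃ f : (ℕ → Bool) → R, Continuous f ∧ ∀ a b, a ≠ b → ¬ E (f a) (f b) := by
  have hg (k : ℕ) (A : Set (ℕ → R × (ℕ → ℕ))) : ∃ B, (B = A ∨ ∃ i, B = splitSet k (h i) A) ∧
      ((∃ i, ∃ᶠ x in fstFilter G, x ∈ splitSet k (h i) A) →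
        (∃ i, B = splitSet k (h i) A) ∧ ∃ᶠ x in fstFilter G, x ∈ B) := by
    by_cases hi : ∃ i, ∃ᶠ x in fstFilter G, x ∈ splitSet k (h i) A
    · obtain ⟨i, hi⟩ := hi
      exact ⟨_, Or.inr ⟨i, rfl⟩, fun _ => ⟨⟨i, rfl⟩, hi⟩⟩
    · exact ⟨A, Or.inl rfl, fun h' => absurd h' hi⟩
  choose g hg hgF using hg
  let op (j : Option (ℕ ⊕ ℕ)) (A B : Set (ℕ → R × (ℕ → ℕ))) : Set (ℕ → R × (ℕ → ℕ)) :=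
    match j with
    | none => A ∩ B
    | some (.inl k) => (· ∘ swapBlocks k) ⁻¹' A
    | some (.inr k) => g k A
  let S : Set (Set (ℕ → R × (ℕ → ℕ))) := insert Set.univ
    (⋃ i, (fun V => {x | x i ∈ closure V}) '' TopologicalSpace.countableBasis (R × (ℕ → ℕ)))
  have hS : S.Countable := (countable_iUnion fun i =>
    (TopologicalSpace.countable_countableBasis (R × (ℕ → ℕ))).image _).insert _
  obtain ⟨𝓑, hS𝓑, h𝓑c, h𝓑op, h𝓑ind⟩ := exists_countable_superset_closed op hS
  have h𝓑 := h𝓑ind (fun A => IsClosed A ∧ ∃ m, DependsOn (· ∈ A) (Iio m)) ?_ ?_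
  · refine exists_continuous_cantor_of_countable_family hE hEa
      (π := fun x : ℕ → R × (ℕ → ℕ) => (x 0).1) (by fun_prop) (fstFilter G) h𝓑c
      (fun A hA => (h𝓑 A hA).1) (hS𝓑 (mem_insert _ _))
      (fun A hA B hB => h𝓑op none A hA B hB) (generateFrom_le_pi fun i V hV => hS𝓑 <|
        mem_insert_of_mem _ (mem_iUnion.2 ⟨i, mem_image_of_mem _ hV⟩))
      (σ := fun k x => x ∘ swapBlocks k)
      (fun k x => by simp [Function.comp_assoc, (swapBlocks_involutive k).comp_self])
      (fun k A hA => h𝓑op (some (.inl k)) A hA A hA)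
      (fun k => tendsto_comp_fstFilter G _) fun A hA hAF => ?_
    obtain ⟨m, hm⟩ := (h𝓑 A hA).2
    obtain ⟨⟨i, hi⟩, hF⟩ := hgF (m + 1) A (exists_frequently_splitSet hGE hGι hh m.succ_pos
      (hm.mono (Iio_subset_Iio m.le_succ)) hAF)
    refine ⟨m + 1, g (m + 1) A, h𝓑op (some (.inr (m + 1))) A hA A hA, ?_, hF, ?_, ?_⟩
    · exact hi ▸ fun x hx => hx.1.1
    · exact hi ▸ fun x hx => hx.1.2
    · intro x hx
      rw [hi] at hx
      have : ((x 0).1, (x (m + 1)).1) ∈ {p : R × R | E p.1 p.2}ᶜ :=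
        hh ▸ mem_iUnion.2 ⟨i, _, hx.2⟩
      simpa [swapBlocks] using this
  · rintro A (rfl | hA)
    · exact ⟨isClosed_univ, 0, fun x y _ => by simp⟩
    · obtain ⟨i, V, -, rfl⟩ := mem_iUnion.1 hA
      exact ⟨isClosed_closure.preimage (continuous_apply i), i + 1,
        fun x y hxy => by simp [hxy i (by simp)]⟩
  · rintro (_ | k | k) A B ⟨hA, m, hm⟩ ⟨hB, n, hn⟩
    · refine ⟨hA.inter hB, max m n, fun x y hxy => ?_⟩
      have h1 := hm fun i hi => hxy i (mem_Iio.2 (lt_max_of_lt_left hi))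
      have h2 := hn fun i hi => hxy i (mem_Iio.2 (lt_max_of_lt_right hi))
      simp only at h1 h2
      simp only [op, mem_inter_iff, h1, h2]
    · exact ⟨hA.preimage (continuous_pi fun _ => continuous_apply _), _, hm.comp_swapBlocks⟩
    · rcases hg k A with hgA | ⟨i, hgA⟩
      · simp only [op, hgA]
        exact ⟨hA, m, hm⟩
      · simp only [op, hgA]
        exact ⟨isClosed_splitSet (hhc i) hA, _, dependsOn_splitSet hm⟩

/-- An analytic equivalence relation with more than `ℵ₁` classes has a Cantor set of pairwise
inequivalent points. -/
theorem exists_continuous_cantor_of_aleph_one_lt {R : Type} [TopologicalSpace R] [PolishSpace R]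
    (s : Setoid R) (hs : MeasureTheory.AnalyticSet {p : R × R | s p.1 p.2})
    (hcard : aleph 1 < #(Quotient s)) :
    ∃ f : (ℕ → Bool) → R, Continuous f ∧ ∀ a b, a ≠ b → ¬ s (f a) (f b) := by
  have hreg : (Order.succ (aleph 1)).IsRegular := isRegular_succ (aleph0_le_aleph 1)
  have hc : ℵ₀ < Order.succ (aleph 1) := (aleph0_le_aleph 1).trans_lt (Order.lt_succ _)
  let C := cocardinal (Quotient s) hreg
  have hCne : NeBot C := by
    rw [← frequently_true_iff_neBot, frequently_cocardinal]
    simpa using Order.succ_le_of_lt hcard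
  let G : Filter R := comap (Quotient.mk s) C
  have : NeBot G := hCne.comap_of_surj Quotient.mk_surjective
  have : CountableInterFilter G := CardinalInterFilter.toCountableInterFilter G hc
  obtain ⟨q, -⟩ : ∃ q : Quotient s, q ∈ Set.univ := nonempty_of_mem (f := C) univ_mem
  obtain ⟨f₀, hf₀, hf₀s⟩ : ∃ f : (ℕ → ℕ) → R × R, Continuous f ∧
      range f = {p : R × R | s p.1 p.2} := by
    rw [MeasureTheory.AnalyticSet] at hs
    exact hs.resolve_left (Nonempty.ne_empty ⟨(q.out, q.out), s.refl _⟩)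
  obtain ⟨ι, h, hι, hh, hhs⟩ := exists_iUnion_range_eq_compl_range hf₀
  exact exists_continuous_cantor_of_filter s.iseqv hs (G := G) (fun r => by
      refine mem_comap.2 ⟨{Quotient.mk s r}ᶜ, (finite_singleton _).compl_mem_cocardinal, ?_⟩
      exact fun r' hr' hE' => hr' (Quotient.sound (s.symm hE')))
    (fun V hV => (cardinal_iInter_mem (Order.lt_succ_of_le hι)).2 hV) hh (hf₀s ▸ hhs)

end Burgess

/-- Burgess's theorem: if `E` is an analytic equivalence relation on `ℝ` with no
nonempty perfect set of pairwise `E`-inequivalent reals, then `E` has at most `ℵ₁`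
equivalence classes. -/
theorem burgess (E : ℝ → ℝ → Prop) (hE : Equivalence E)
    (hanalytic : MeasureTheory.AnalyticSet {p : ℝ × ℝ | E p.1 p.2})
    (hthin : ¬ ∃ P : Set ℝ, Perfect P ∧ P.Nonempty ∧
      ∀ x ∈ P, ∀ y ∈ P, x ≠ y → ¬ E x y) :
    #(Quotient (⟨E, hE⟩ : Setoid ℝ)) ≤ aleph 1 := by
  by_contra! hcard
  obtain ⟨f, hf, hfE⟩ := exists_continuous_cantor_of_aleph_one_lt ⟨E, hE⟩ hanalytic hcard
  have hcantor : ℵ₀ < #(ℕ → Bool) := by simpa using cantor ℵ₀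
  have hinj : Function.Injective f := fun a b hab => by
    by_contra hne
    exact hfE a b hne (hab ▸ hE.refl _)
  obtain ⟨P, hP, hPne, hPf⟩ := exists_perfect_nonempty_of_isClosed_of_not_countable
    (isCompact_range hf).isClosed fun hcount => by
      have := hcount.to_subtype
      have : Countable (ℕ → Bool) := (Set.rangeFactorization_injective.2 hinj).countable
      exact hcantor.not_ge mk_le_aleph0
  refine hthin ⟨P, hP, hPne, fun x hx y hy hxy => ?_⟩
  obtain ⟨a, rfl⟩ := hPf hx
  obtain ⟨b, rfl⟩ := hPf hy
  exact hfE a b fun h => hxy (h ▸ rfl)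
end
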